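/- arXiv:2212.13806 — 6 statements merged into one kernel-verified Lean document; each statement's English description precedes it below -/
import Mathlib

section
/- Let m, n be positive integers. Let f be a polynomial in the n·m² variables x^k_{ij} (1 ≤ i,j ≤ m, 1 ≤ k ≤ n) over ℂ that is multilinear (homogeneous of degree 1 in each block of variables {x^k_{ij}}_{i,j} for every fixed k) and GLₘ-invariant, i.e. f(gX₁g⁻¹,…,gXₙg⁻¹) = f(X₁,…,Xₙ) for every invertible m×m complex matrix g, where Xₖ = (x^k_{ij})_{ij} is the k-th generic matrix. Then f is a ℂ-linear combination of the polynomials T_σ, σ ∈ 𝔖ₙ, where for a permutation σ with cycle decomposition (i₁…i_k)⋯(j₁…j_ℓ) one sets T_σ = Tr(X_{i₁}⋯X_{i_k})⋯Tr(X_{j₁}⋯X_{j_ℓ}). -/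
/-- The `k`-th generic `m × m` matrix `Xₖ = (x^k_{ij})_{ij}`, a matrix over the
polynomial ring `ℂ[x^k_{ij} : 1 ≤ i,j ≤ m, 1 ≤ k ≤ n]`. -/
noncomputable def genMat (m n : ℕ) (k : Fin n) :
    Matrix (Fin m) (Fin m) (MvPolynomial (Fin n × Fin m × Fin m) ℂ) :=
  Matrix.of fun i j => MvPolynomial.X (k, i, j)

/-- The weight function selecting the block of variables `{x^k_{ij}}_{i,j}` of the
`k`-th generic matrix: multilinearity means weighted-homogeneity of degree 1 for
each of these weights. -/
def blockWeight (m n : ℕ) (k : Fin n) : Fin n × Fin m × Fin m → ℕ :=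
  fun v => if v.1 = k then 1 else 0

/-- `f` is invariant under simultaneous conjugation of the generic matrices
`X₁, …, Xₙ` by every invertible complex `m × m` matrix `g`, i.e.
`f(gX₁g⁻¹, …, gXₙg⁻¹) = f(X₁, …, Xₙ)`. -/
def IsConjInvariant {m n : ℕ} (f : MvPolynomial (Fin n × Fin m × Fin m) ℂ) : Prop :=
  ∀ g : Matrix (Fin m) (Fin m) ℂ, IsUnit g →
    MvPolynomial.aeval
      (fun v : Fin n × Fin m × Fin m =>
        (g.map MvPolynomial.C * genMat m n v.1 * g⁻¹.map MvPolynomial.C :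
          Matrix (Fin m) (Fin m) (MvPolynomial (Fin n × Fin m × Fin m) ℂ)) v.2.1 v.2.2) f = f

/-- The trace monomial `T_σ` attached to a permutation `σ ∈ 𝔖ₙ`: if `σ` has cycle
decomposition `(i₁…i_k)⋯(j₁…j_ℓ)`, then `T_σ = Tr(X_{i₁}⋯X_{i_k})⋯Tr(X_{j₁}⋯X_{j_ℓ})`.
Explicitly, `T_σ = Σ_{J : [n] → [m]} ∏_{t=1}^{n} (X_t)_{J(t), J(σ(t))}`, which is the
product over the cycles of `σ` of the traces of the products of the generic matrices
along each cycle. -/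
noncomputable def tracePerm (m n : ℕ) (σ : Equiv.Perm (Fin n)) :
    MvPolynomial (Fin n × Fin m × Fin m) ℂ :=
  ∑ J : Fin n → Fin m, ∏ t : Fin n, MvPolynomial.X (t, J t, J (σ t))

/-- A linear endomorphism of a matrix algebra commutes with left multiplication by `R` if and only
if its blocks, each sending the `j`-th column of the input to the `k`-th column of the output,
commute with `R`. -/
theorem map_mul_left_iff_commute_blocks {ι K : Type*} [Field K] [Fintype ι] [DecidableEq ι]
    (p : Matrix ι ι K →ₗ[K] Matrix ι ι K) (R : Matrix ι ι K) :
    (∀ X, p (R * X) = R * p X) ↔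
      ∀ j k, Commute R (Matrix.of fun a b => p (Matrix.single b j 1) a k) := by
  have hcol : ∀ c j, R * Matrix.single c j 1 = ∑ b, R b c • Matrix.single b j (1 : K) := by
    intro c j
    ext a d
    simp [Matrix.sum_apply, Matrix.mul_apply, Matrix.single_apply, ite_and]
  have hleft : ∀ j k a c, ((Matrix.of fun a b => p (Matrix.single b j 1) a k) * R) a c =
      p (R * Matrix.single c j 1) a k := by
    intro j k a c
    rw [hcol, map_sum, Matrix.sum_apply, Matrix.mul_apply]
    exact Finset.sum_congr rfl fun b _ => by rw [map_smul]; exact mul_comm _ _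
  have hright : ∀ j k a c, (R * (Matrix.of fun a b => p (Matrix.single b j 1) a k)) a c =
      (R * p (Matrix.single c j 1)) a k := by
    intro j k a c
    simp [Matrix.mul_apply]
  constructor
  · intro h j k
    ext a c
    rw [hleft, hright, h]
  · intro h X
    have hlin : p ∘ₗ LinearMap.mulLeft K R = LinearMap.mulLeft K R ∘ₗ p := by
      refine Matrix.ext_linearMap (R := K) fun c j => LinearMap.ext_ring ?_
      ext a k
      have := congrFun (congrFun (h j k).eq a) c
      rw [hleft, hright] at this
      simpa using this.symm
    exact LinearMap.congr_fun hlin X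

/-- The double centralizer theorem for a matrix representation of a finite group: a matrix
commuting with the centralizer of the representation is a combination of its values. -/
theorem mem_span_range_of_commute_centralizer {G ι K : Type*} [Group G] [Fintype G] [Field K]
    [CharZero K] [Fintype ι] [DecidableEq ι] (ρ : G →* Matrix ι ι K) (M : Matrix ι ι K)
    (hM : ∀ E, (∀ g, Commute (ρ g) E) → Commute M E) :
    M ∈ Submodule.span K (Set.range ρ) := by
  set A := Submodule.span K (Set.range ρ) with hA
  have hρA : ∀ g, ∀ X ∈ A, ρ g * X ∈ A := by
    intro g X hX
    have : A ≤ A.comap (LinearMap.mulLeft K (ρ g)) := by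
      rw [hA, Submodule.span_le]
      rintro _ ⟨h, rfl⟩
      exact Submodule.subset_span ⟨g * h, by simp⟩
    exact this hX
  obtain ⟨q, hq⟩ := A.subtype.exists_leftInverse_of_injective A.ker_subtype
  have hqA : ∀ X (hX : X ∈ A), (q X : Matrix ι ι K) = X := fun X hX =>
    congrArg Subtype.val (LinearMap.congr_fun hq ⟨X, hX⟩)
  let p : Matrix ι ι K →ₗ[K] Matrix ι ι K :=
    ∑ g, LinearMap.mulLeft K (ρ g) ∘ₗ A.subtype ∘ₗ q ∘ₗ LinearMap.mulLeft K (ρ g⁻¹)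
  have hp : ∀ X, p X = ∑ g, ρ g * (q (ρ g⁻¹ * X) : Matrix ι ι K) := by
    intro X
    simp [p, LinearMap.sum_apply]
  have hpA : ∀ X, p X ∈ A := fun X => by
    rw [hp]
    exact Submodule.sum_mem _ fun g _ => hρA g _ (q _).2
  have hpG : ∀ h X, p (ρ h * X) = ρ h * p X := by
    intro h X
    rw [hp, hp, Finset.mul_sum, ← Equiv.sum_comp (Equiv.mulLeft h)]
    refine Finset.sum_congr rfl fun g _ => ?_
    simp only [Equiv.coe_mulLeft, map_mul, mul_inv_rev, ← mul_assoc]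
    rw [mul_assoc (ρ g⁻¹), ← map_mul ρ h⁻¹ h]
    simp
  have hpM : ∀ X, p (M * X) = M * p X :=
    (map_mul_left_iff_commute_blocks p M).2 fun j k =>
      hM _ fun g => (map_mul_left_iff_commute_blocks p (ρ g)).1 (hpG g) j k
  have hp_one : p 1 = (Fintype.card G : K) • 1 := by
    rw [hp]
    have : ∀ g, ρ g * (q (ρ g⁻¹ * 1) : Matrix ι ι K) = 1 := by
      intro g
      rw [mul_one, hqA _ (Submodule.subset_span ⟨_, rfl⟩), ← map_mul, mul_inv_cancel, map_one]
    simp only [this, Finset.sum_const, Finset.card_univ, Nat.cast_smul_eq_nsmul]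
  have hcard : (Fintype.card G : K) ≠ 0 := Nat.cast_ne_zero.2 Fintype.card_ne_zero
  have hmem := hpA (M * 1)
  rw [hpM, hp_one, mul_smul_comm, mul_one] at hmem
  exact (A.smul_mem_iff hcard).1 hmem

/-- The action of a permutation of the tensor factors on `(K^κ)^{⊗ τ}`, as a matrix in the standard
basis. -/
def tensorPermMatrix (τ κ K : Type*) [Field K] [Fintype τ] [DecidableEq τ] [Fintype κ]
    [DecidableEq κ] : Equiv.Perm τ →* Matrix (τ → κ) (τ → κ) K where
  toFun σ := Matrix.of fun I J => if J = I ∘ σ then 1 else 0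
  map_one' := by
    ext I J
    simp [Matrix.one_apply, eq_comm]
  map_mul' σ π := by
    ext I J
    rw [Matrix.mul_apply, Finset.sum_eq_single (I ∘ σ)]
    · simp only [Matrix.of_apply, if_true, one_mul]
      rfl
    · intro L _ hL
      simp [hL]
    · simp

/-- Matrices commuting with all permutations of the tensor factors have entries that are constant
along simultaneous permutations of the multi-indices. -/
theorem apply_comp_of_commute_tensorPermMatrix {τ κ K : Type*} [Field K] [Fintype τ]
    [DecidableEq τ] [Fintype κ] [DecidableEq κ] {E : Matrix (τ → κ) (τ → κ) K}
    {σ : Equiv.Perm τ} (h : Commute (tensorPermMatrix τ κ K σ) E) (I J : τ → κ) :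
    E (I ∘ σ) (J ∘ σ) = E I J := by
  have := congrFun (congrFun h.eq I) (J ∘ σ)
  have hinj : ∀ L : τ → κ, J ∘ σ = L ∘ σ ↔ L = J := fun L =>
    ⟨fun h => (σ.surjective.injective_comp_right h).symm, fun h => h ▸ rfl⟩
  simpa [tensorPermMatrix, Matrix.mul_apply, hinj] using this

/-- Two families with the same multiset of values differ by a permutation of the indices. -/
theorem exists_perm_comp_eq_of_sum_single_eq {τ α : Type*} [Fintype τ] {F H : τ → α}
    (h : ∑ t, Finsupp.single (F t) 1 = ∑ t, Finsupp.single (H t) 1) :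
    ∃ σ : Equiv.Perm τ, H ∘ σ = F := by
  classical
  have hcard : ∀ v, Nonempty ({t // F t = v} ≃ {t // H t = v}) := by
    intro v
    rw [← Fintype.card_eq, Fintype.card_subtype, Fintype.card_subtype]
    have := DFunLike.congr_fun h v
    simpa [Finsupp.finsetSum_apply, Finsupp.single_apply] using this
  exact ⟨Equiv.ofFiberEquiv fun v => (hcard v).some, funext fun t => Equiv.ofFiberEquiv_map _ t⟩

open MvPolynomial in
/-- A matrix on `(K^κ)^{⊗ τ}` commuting with the `τ`-th tensor power of the generic `κ × κ` matrix
commutes with every matrix commuting with the permutations of the tensor factors. -/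
theorem commute_of_commute_generic_tensorPower {τ κ K : Type*} [Field K] [Fintype τ]
    [DecidableEq τ] [Fintype κ] [DecidableEq κ] {M E : Matrix (τ → κ) (τ → κ) K}
    (hM : ∀ I J : τ → κ, ∑ L, C (M I L) * ∏ t, X (L t, J t) =
      (∑ L, C (M L J) * ∏ t, X (I t, L t) : MvPolynomial (κ × κ) K))
    (hE : ∀ σ, Commute (tensorPermMatrix τ κ K σ) E) : Commute M E := by
  classical
  let d : (τ → κ) × (τ → κ) → (κ × κ →₀ ℕ) := fun p => ∑ t, Finsupp.single (p.1 t, p.2 t) 1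
  have hd : Function.FactorsThrough (fun p : (τ → κ) × (τ → κ) => E p.1 p.2) d := by
    intro p r h
    obtain ⟨σ, hσ⟩ := exists_perm_comp_eq_of_sum_single_eq h
    have h₁ : p.1 = r.1 ∘ σ := funext fun t => (congrArg Prod.fst (congrFun hσ t)).symm
    have h₂ : p.2 = r.2 ∘ σ := funext fun t => (congrArg Prod.snd (congrFun hσ t)).symm
    simp only [h₁, h₂]
    exact apply_comp_of_commute_tensorPermMatrix (hE σ) _ _
  let φ : MvPolynomial (κ × κ) K →ₗ[K] K := (basisMonomials (κ × κ) K).constr K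
    (Function.extend d (fun p => E p.1 p.2) 0)
  have hφ : ∀ (a : K) (I J : τ → κ), φ (C a * ∏ t, X (I t, J t)) = a * E I J := by
    intro a I J
    have hmon : (∏ t, X (I t, J t) : MvPolynomial (κ × κ) K) =
        basisMonomials (κ × κ) K (d (I, J)) := by
      simp [d, X, monomial_sum_one]
    rw [C_mul', map_smul, hmon, Module.Basis.constr_basis, hd.extend_apply, smul_eq_mul]
  ext I J
  have := congrArg φ (hM I J)
  simp only [map_sum, hφ] at this
  rw [Matrix.mul_apply, Matrix.mul_apply, this]
  exact Finset.sum_congr rfl fun _ _ => mul_comm _ _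

open MvPolynomial in
/-- A polynomial of degree one in each block of variables is a combination of the products of one
variable from each block. -/
theorem mem_span_prod_X_of_isWeightedHomogeneous {m n : ℕ}
    {f : MvPolynomial (Fin n × Fin m × Fin m) ℂ}
    (hml : ∀ k : Fin n, f.IsWeightedHomogeneous (blockWeight m n k) 1) :
    f ∈ Submodule.span ℂ (Set.range fun p : (Fin n → Fin m) × (Fin n → Fin m) =>
      (∏ t, X (t, p.1 t, p.2 t) : MvPolynomial (Fin n × Fin m × Fin m) ℂ)) := by
  rw [f.as_sum]
  refine Submodule.sum_mem _ fun d hd => ?_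
  rw [← mul_one (coeff d f), ← smul_eq_mul, ← smul_monomial]
  refine Submodule.smul_mem _ _ (Submodule.subset_span ?_)
  have hw : ∀ k, ∑ ij : Fin m × Fin m, d (k, ij) = 1 := by
    intro k
    have := hml k (mem_support_iff.1 hd)
    rw [Finsupp.weight_eq_sum, Fintype.sum_prod_type] at this
    simpa [blockWeight, Finset.sum_ite_eq, ← Finset.sum_mul] using this
  have hq : ∀ k, ∃ ij : Fin m × Fin m, ∀ ij', d (k, ij') = if ij = ij' then 1 else 0 := by
    intro k
    obtain ⟨ij, hij⟩ := Finsupp.sum_eq_one_iff (Finsupp.equivFunOnFinite.symm fun v => d (k, v))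
      |>.1 (by rw [Finsupp.sum_fintype _ _ (by simp)]; simpa using hw k)
    refine ⟨ij, fun ij' => ?_⟩
    have := DFunLike.congr_fun hij ij'
    simpa [Finsupp.single_apply, eq_comm] using this.symm
  choose q hq using hq
  refine ⟨(fun t => (q t).1, fun t => (q t).2), ?_⟩
  simp only [X, ← monomial_sum_one]
  refine congrArg (fun d => monomial d (1 : ℂ)) (Finsupp.ext fun ⟨k, v⟩ => ?_)
  simp [Finsupp.finsetSum_apply, Finsupp.single_apply, hq, ite_and]

open MvPolynomial in
/-- Conjugation invariance in the form `f(gA₁, …, gAₙ) = f(A₁g, …, Aₙg)`. -/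
theorem IsConjInvariant.eval_mul_left_eq_eval_mul_right {m n : ℕ}
    {f : MvPolynomial (Fin n × Fin m × Fin m) ℂ} (hinv : IsConjInvariant f)
    {g : Matrix (Fin m) (Fin m) ℂ} (hg : IsUnit g) (A : Fin n → Matrix (Fin m) (Fin m) ℂ) :
    eval (fun v => (g * A v.1) v.2.1 v.2.2) f = eval (fun v => (A v.1 * g) v.2.1 v.2.2) f := by
  conv_rhs => rw [← hinv g hg]
  rw [← coe_aeval_eq_eval, ← coe_aeval_eq_eval, RingHom.coe_coe, RingHom.coe_coe,
    ← AlgHom.comp_apply, comp_aeval]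
  congr 2
  funext v
  have : g * A v.1 = g * (A v.1 * g) * g⁻¹ := by
    rw [← Matrix.mul_assoc, Matrix.mul_assoc,
      Matrix.mul_nonsing_inv g ((Matrix.isUnit_iff_isUnit_det g).1 hg), Matrix.mul_one]
  rw [this]
  simp [Matrix.mul_apply, genMat]

open MvPolynomial in
/-- The coefficient matrix of a conjugation invariant multilinear polynomial commutes with the
tensor power of the generic matrix. -/
theorem IsConjInvariant.coeff_commute_generic {m n : ℕ}
    {c : (Fin n → Fin m) × (Fin n → Fin m) → ℂ}
    (hinv : IsConjInvariant
      (∑ p, c p • ∏ t, X (t, p.1 t, p.2 t) : MvPolynomial (Fin n × Fin m × Fin m) ℂ))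
    (I J : Fin n → Fin m) :
    ∑ L, C (c (L, I)) * ∏ t, X (L t, J t) =
      (∑ L, C (c (J, L)) * ∏ t, X (I t, L t) : MvPolynomial (Fin m × Fin m) ℂ) := by
  refine eq_of_eval_eq_on_gl fun g => ?_
  have h := hinv.eval_mul_left_eq_eval_mul_right g.isUnit fun t => Matrix.single (J t) (I t) 1
  have hprod : ∀ (a : Fin n → ℂ) (L L' : Fin n → Fin m),
      ∏ t, (if L t = L' t then a t else 0) = if L = L' then ∏ t, a t else 0 := by
    intro a L L'
    rw [Finset.prod_ite_zero]
    simp [funext_iff]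
  simpa [Matrix.mul_apply, Matrix.single_apply, ite_and, hprod, Fintype.sum_prod_type,
    smul_eval] using h

/-- **The multilinear invariants of matrices** (Theorem 1.3, surjectivity): every
multilinear `GLₘ`-invariant polynomial in the entries of the generic matrices
`X₁, …, Xₙ` is a ℂ-linear combination of the trace monomials `T_σ`, `σ ∈ 𝔖ₙ`. -/
theorem multilinear_invariant_mem_span_tracePerm (m n : ℕ) (hm : 0 < m) (hn : 0 < n)
    (f : MvPolynomial (Fin n × Fin m × Fin m) ℂ)
    (hml : ∀ k : Fin n, f.IsWeightedHomogeneous (blockWeight m n k) 1)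
    (hinv : IsConjInvariant f) :
    f ∈ Submodule.span ℂ (Set.range (tracePerm m n)) := by
  obtain ⟨c, rfl⟩ := (Submodule.mem_span_range_iff_exists_fun ℂ).1
    (mem_span_prod_X_of_isWeightedHomogeneous hml)
  let Φ : Matrix (Fin n → Fin m) (Fin n → Fin m) ℂ →ₗ[ℂ]
      MvPolynomial (Fin n × Fin m × Fin m) ℂ :=
    ∑ p : (Fin n → Fin m) × (Fin n → Fin m),
      (Matrix.entryLinearMap ℂ ℂ p.2 p.1).smulRight (∏ t, MvPolynomial.X (t, p.1 t, p.2 t))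
  have hΦ : ∀ M, Φ M = ∑ p : (Fin n → Fin m) × (Fin n → Fin m),
      M p.2 p.1 • ∏ t, MvPolynomial.X (t, p.1 t, p.2 t) := fun M => by
    simp [Φ, LinearMap.sum_apply]
  have hmem := mem_span_range_of_commute_centralizer (tensorPermMatrix (Fin n) (Fin m) ℂ)
    (Matrix.of fun I J => c (J, I)) fun E hE =>
      commute_of_commute_generic_tensorPower hinv.coeff_commute_generic hE
  have hspan : Submodule.span ℂ (Set.range (tensorPermMatrix (Fin n) (Fin m) ℂ)) ≤
      (Submodule.span ℂ (Set.range (tracePerm m n))).comap Φ := by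
    rw [Submodule.span_le]
    rintro _ ⟨σ, rfl⟩
    refine Submodule.subset_span ⟨σ⁻¹, ?_⟩
    have hσ : ∀ I J : Fin n → Fin m, I = J ∘ σ ↔ J = I ∘ ⇑σ⁻¹ := fun I J => by
      rw [Equiv.Perm.inv_def, Equiv.eq_comp_symm, eq_comm]
    simp [hΦ, tracePerm, tensorPermMatrix, Fintype.sum_prod_type, hσ]
  simpa [hΦ] using hspan hmem
end

section
/- Let m, n be positive integers with n ≤ m. Then the polynomials T_σ, σ ∈ 𝔖ₙ, are linearly independent over ℂ, where for a permutation σ ∈ 𝔖ₙ with cycle decomposition (i₁…i_k)⋯(j₁…j_ℓ) one sets T_σ = Tr(X_{i₁}⋯X_{i_k})⋯Tr(X_{j₁}⋯X_{j_ℓ}), a polynomial in the entries of the generic m×m matrices X₁,…,Xₙ. -/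
/-- Evaluating `T_τ` with `X_t` the matrix unit at `(t, σ t)` (indices embedded in `Fin m`)
detects whether `τ = σ`. -/
theorem eval_tracePerm_matrixUnits {m n : ℕ} (hnm : n ≤ m) (σ τ : Equiv.Perm (Fin n)) :
    MvPolynomial.eval (fun p : Fin n × Fin m × Fin m =>
      if p.2.1 = Fin.castLE hnm p.1 ∧ p.2.2 = Fin.castLE hnm (σ p.1) then (1 : ℂ) else 0)
      (tracePerm m n τ) = if τ = σ then 1 else 0 := by
  have h (J : Fin n → Fin m) :
      (∀ t ∈ Finset.univ, J t = Fin.castLE hnm t ∧ J (τ t) = Fin.castLE hnm (σ t)) ↔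
        J = Fin.castLE hnm ∧ τ = σ := by
    constructor
    · intro h
      have hJ : J = Fin.castLE hnm := funext fun t => (h t (Finset.mem_univ t)).1
      refine ⟨hJ, Equiv.ext fun t => Fin.castLE_injective hnm ?_⟩
      rw [← (h t (Finset.mem_univ t)).2, hJ]
    · rintro ⟨rfl, rfl⟩ t _
      exact ⟨rfl, rfl⟩
  simp only [tracePerm, map_sum, map_prod, MvPolynomial.eval_X, Finset.prod_ite_zero,
    Finset.prod_const_one, h]
  simp only [ite_and, Finset.sum_ite_eq', Finset.mem_univ, if_true]

/-- If `n ≤ m`, the trace monomials `T_σ`, `σ ∈ 𝔖ₙ`, in the entries of the generic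
`m × m` matrices `X₁, …, Xₙ`, are linearly independent over ℂ. -/
theorem tracePerm_linearIndependent (m n : ℕ) (hm : 0 < m) (hn : 0 < n) (hnm : n ≤ m) :
    LinearIndependent ℂ (tracePerm m n) := by
  rw [Fintype.linearIndependent_iff]
  intro g hg σ
  have h := congrArg (MvPolynomial.eval (fun p : Fin n × Fin m × Fin m =>
    if p.2.1 = Fin.castLE hnm p.1 ∧ p.2.2 = Fin.castLE hnm (σ p.1) then (1 : ℂ) else 0)) hg
  simpa only [map_sum, MvPolynomial.smul_eval, eval_tracePerm_matrixUnits, map_zero, mul_ite,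
    mul_one, mul_zero, Finset.sum_ite_eq', Finset.mem_univ, if_true] using h
end

section
/- Let m, n be positive integers and fix a multidegree (d₁,…,dₙ) ∈ ℕⁿ with d = Σᵢ dᵢ. Let f be a polynomial in the entries of the generic m×m matrices X₁,…,Xₙ which is homogeneous of degree dᵢ in the entries of Xᵢ for each i, and is GLₘ-invariant: f(gX₁g⁻¹,…,gXₙg⁻¹) = f(X₁,…,Xₙ) for every invertible m×m complex matrix g. Then f is a ℂ-linear combination of products of traces Tr(X_{i₁}⋯X_{i_k})⋯Tr(X_{j₁}⋯X_{j_ℓ}) of words in X₁,…,Xₙ, in which the matrix Xᵢ occurs exactly dᵢ times in total, for each i. -/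
/-- The trace `Tr(X_{i₁} ⋯ X_{i_k})` of the word `w = (i₁, …, i_k)` in the generic
matrices. -/
noncomputable def traceWord (m n : ℕ) (w : List (Fin n)) :
    MvPolynomial (Fin n × Fin m × Fin m) ℂ :=
  Matrix.trace (w.map (genMat m n)).prod

section Exponent

variable {ι V : Type*} [Fintype ι]

/-- The exponent of the monomial `∏ a, X (F a)`. -/
noncomputable def tupleExponent (F : ι → V) : V →₀ ℕ :=
  ∑ a, Finsupp.single (F a) 1

theorem tupleExponent_apply [DecidableEq V] (F : ι → V) (v : V) :
    tupleExponent F v = Fintype.card {a // F a = v} := by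
  simp [tupleExponent, Finsupp.finsetSum_apply, Finsupp.single_apply, Fintype.card_subtype]

theorem tupleExponent_comp_perm (F : ι → V) (σ : Equiv.Perm ι) :
    tupleExponent (F ∘ σ) = tupleExponent F :=
  Equiv.sum_comp σ fun a => Finsupp.single (F a) 1

theorem exists_perm_of_tupleExponent_eq {F G : ι → V}
    (h : tupleExponent F = tupleExponent G) : ∃ σ : Equiv.Perm ι, G ∘ σ = F := by
  classical
  have hcard (v : V) : Fintype.card {a // F a = v} = Fintype.card {a // G a = v} := by
    rw [← tupleExponent_apply F, h, tupleExponent_apply]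
  refine ⟨Equiv.ofFiberEquiv fun v => Fintype.equivOfCardEq (hcard v), ?_⟩
  funext a
  exact Equiv.ofFiberEquiv_map _ a

theorem exists_tupleExponent_eq {d : ℕ} (s : V →₀ ℕ) (hs : s.degree = d) :
    ∃ F : Fin d → V, tupleExponent F = s := by
  classical
  obtain ⟨l, hl⟩ : ∃ l : List V, (l : Multiset V) = Finsupp.toMultiset s := Quot.exists_rep _
  have hlen : l.length = d := by
    rw [← hs, ← Multiset.coe_card, hl, Finsupp.card_toMultiset]
    rfl
  subst hlen
  refine ⟨l.get, ?_⟩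
  apply Multiset.toFinsupp.symm.injective
  change Finsupp.toMultiset _ = Finsupp.toMultiset _
  rw [← hl, tupleExponent, map_sum]
  simp only [Finsupp.toMultiset_single, one_smul]
  rw [← Multiset.sum_map_singleton (l : Multiset V)]
  exact Fin.sum_univ_fun_getElem l fun v => ({v} : Multiset V)

theorem prod_X_eq_monomial {R : Type*} [CommSemiring R] (F : ι → V) :
    ∏ a, (MvPolynomial.X (F a) : MvPolynomial V R) =
      MvPolynomial.monomial (tupleExponent F) 1 := by
  simp [tupleExponent, MvPolynomial.monomial_sum_one, MvPolynomial.X]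

end Exponent

section KroneckerPower

variable {ι V R : Type*} [Fintype ι] [CommRing R]

/-- The `ι`-fold Kronecker power of a square matrix. -/
def kroneckerPower (ι : Type*) [Fintype ι] (A : Matrix V V R) : Matrix (ι → V) (ι → V) R :=
  Matrix.of fun P Q => ∏ a, A (P a) (Q a)

theorem kroneckerPower_mul [DecidableEq ι] [Fintype V] (A B : Matrix V V R) :
    kroneckerPower ι (A * B) = kroneckerPower ι A * kroneckerPower ι B := by
  ext P Q
  simp [kroneckerPower, Matrix.mul_apply, Finset.prod_univ_sum, Fintype.piFinset_univ,
    Finset.prod_mul_distrib]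

theorem kroneckerPower_one [DecidableEq ι] [DecidableEq V] :
    kroneckerPower ι (1 : Matrix V V R) = 1 := by
  ext P Q
  simp [kroneckerPower, Matrix.one_apply, Finset.prod_ite_zero, funext_iff]

variable [Fintype V] [DecidableEq V] [DecidableEq ι]

/-- A matrix commuting with the Kronecker powers of all invertible matrices commutes with the
Kronecker power of the generic matrix. -/
theorem commute_kroneckerPower_mvPolynomialX {K : Type*} [Field K] [Infinite K]
    {C : Matrix (ι → V) (ι → V) K}
    (hC : ∀ g : Matrix V V K, IsUnit g → Commute (kroneckerPower ι g) C) :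
    Commute (kroneckerPower ι (Matrix.mvPolynomialX V V K)) (C.map MvPolynomial.C) := by
  ext1 P Q
  apply mul_left_cancel₀ (Matrix.det_mvPolynomialX_ne_zero V K)
  apply MvPolynomial.funext
  intro x
  set g : Matrix V V K := Matrix.of fun i j => x (i, j) with hg
  have hdet : MvPolynomial.eval x (Matrix.mvPolynomialX V V K).det = g.det := by
    rw [RingHom.map_det]
    congr 1
    ext i j
    simp [hg]
  rw [map_mul, map_mul, hdet]
  by_cases h0 : g.det = 0
  · simp [h0]
  · congr 1
    have h := congrFun (congrFun (hC g ((Matrix.isUnit_iff_isUnit_det g).2 (Ne.isUnit h0))).eq P) Q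
    simpa [Matrix.mul_apply, kroneckerPower, hg] using h

/-- A matrix commuting with the Kronecker powers of all invertible matrices commutes with every
permutation-invariant matrix. -/
theorem commute_of_commute_kroneckerPower {K : Type*} [Field K] [Infinite K]
    {B C : Matrix (ι → V) (ι → V) K}
    (hC : ∀ g : Matrix V V K, IsUnit g → Commute (kroneckerPower ι g) C)
    (hB : ∀ (σ : Equiv.Perm ι) (P Q : ι → V), B (P ∘ σ) (Q ∘ σ) = B P Q) :
    Commute B C := by
  let e (P Q : ι → V) : V × V →₀ ℕ := tupleExponent fun a => (P a, Q a)
  have hfac : Function.FactorsThrough (fun F : (ι → V) × (ι → V) => B F.1 F.2)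
      (fun F => e F.1 F.2) := by
    rintro ⟨P, Q⟩ ⟨P', Q'⟩ h
    obtain ⟨σ, hσ⟩ := exists_perm_of_tupleExponent_eq h
    have hP : P' ∘ σ = P := funext fun a => congrArg Prod.fst (congrFun hσ a)
    have hQ : Q' ∘ σ = Q := funext fun a => congrArg Prod.snd (congrFun hσ a)
    simp only [← hP, ← hQ, hB]
  let b := Function.extend (fun F : (ι → V) × (ι → V) => e F.1 F.2) (fun F => B F.1 F.2) 0
  have hb (P Q) : b (e P Q) = B P Q := hfac.extend_apply 0 (P, Q)
  let L : MvPolynomial (V × V) K →ₗ[K] K := (MvPolynomial.basisMonomials (V × V) K).constr K b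
  have hL (P Q) : L (kroneckerPower ι (Matrix.mvPolynomialX V V K) P Q) = B P Q := by
    have : kroneckerPower ι (Matrix.mvPolynomialX V V K) P Q =
        MvPolynomial.basisMonomials (V × V) K (e P Q) := by
      simp [kroneckerPower, e, ← prod_X_eq_monomial]
    rw [this, Module.Basis.constr_basis, hb]
  ext1 P Q
  have h := congrArg L
    (congrFun (congrFun (commute_kroneckerPower_mvPolynomialX hC).eq P) Q)
  simp only [Matrix.mul_apply, Matrix.map_apply, map_sum, mul_comm _ (MvPolynomial.C _),
    MvPolynomial.C_mul', map_smul, hL, smul_eq_mul] at h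
  simpa only [Matrix.mul_apply, mul_comm (C _ _)] using h.trans (by simp [mul_comm])

/-- The permutation action on the index functions of a tensor power. -/
def tensorPermRep (ι V K : Type*) [CommSemiring K] :
    Representation K (Equiv.Perm ι) ((ι → V) → K) where
  toFun σ := LinearMap.funLeft K K fun P : ι → V => P ∘ σ
  map_one' := rfl
  map_mul' _ _ := rfl

theorem tensorPermRep_apply {ι V K : Type*} [CommSemiring K] (σ : Equiv.Perm ι)
    (v : (ι → V) → K) (P : ι → V) : tensorPermRep ι V K σ v P = v (P ∘ σ) :=
  rfl

/-- A matrix commuting with every permutation-invariant matrix is a linear combination of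
permutation matrices. -/
theorem exists_eq_sum_perm_of_commute {K : Type*} [Field K] [CharZero K]
    {C : Matrix (ι → V) (ι → V) K}
    (hC : ∀ B : Matrix (ι → V) (ι → V) K,
      (∀ (σ : Equiv.Perm ι) (P Q : ι → V), B (P ∘ σ) (Q ∘ σ) = B P Q) → Commute B C) :
    ∃ r : Equiv.Perm ι → K, ∀ P Q, C P Q = ∑ σ : Equiv.Perm ι, if P ∘ σ = Q then r σ else 0 := by
  let ρ := tensorPermRep ι V K
  have : NeZero (Nat.card (Equiv.Perm ι) : K) := ⟨by simp⟩
  have : IsSemisimpleModule (MonoidAlgebra K (Equiv.Perm ι)) ρ.asModule :=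
    (Representation.isSemisimpleRepresentation_iff_isSemisimpleModule_asModule ρ).1 inferInstance
  have hcomm (φ : Module.End (MonoidAlgebra K (Equiv.Perm ι)) ρ.asModule)
      (v : ρ.asModule) : ρ.asModuleEquiv.symm (C.mulVec (ρ.asModuleEquiv (φ v))) =
        φ (ρ.asModuleEquiv.symm (C.mulVec (ρ.asModuleEquiv v))) := by
    let φ' : ((ι → V) → K) →ₗ[K] ((ι → V) → K) :=
      ρ.asModuleEquiv.toLinearMap ∘ₗ φ.restrictScalars K ∘ₗ ρ.asModuleEquiv.symm.toLinearMap
    have hφ' (σ : Equiv.Perm ι) (w : (ι → V) → K) : φ' (ρ σ w) = ρ σ (φ' w) := by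
      simp only [φ', LinearMap.comp_apply, LinearEquiv.coe_coe, LinearMap.restrictScalars_apply,
        Representation.asModuleEquiv_symm_map_rho, map_smul,
        Representation.asModuleEquiv_map_smul, Representation.asAlgebraHom_of]
    have hB := hC (LinearMap.toMatrix' φ') fun σ P Q => by
      rw [LinearMap.toMatrix'_apply, LinearMap.toMatrix'_apply]
      change ρ σ (φ' (Pi.single (Q ∘ σ) 1)) P = _
      rw [← hφ']
      refine congrFun (congrArg φ' ?_) P
      funext P'
      simp [ρ, tensorPermRep_apply, Pi.single_apply, σ.surjective.right_cancellable]
    have := congrArg (fun M => M.mulVec (ρ.asModuleEquiv v)) hB.eq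
    simp only [← Matrix.mulVec_mulVec, LinearMap.toMatrix'_mulVec] at this
    rw [LinearEquiv.symm_apply_eq]
    exact this.symm
  let f : Module.End (Module.End (MonoidAlgebra K (Equiv.Perm ι)) ρ.asModule) ρ.asModule :=
    { toFun v := ρ.asModuleEquiv.symm (C.mulVec (ρ.asModuleEquiv v))
      map_add' v w := by simp [Matrix.mulVec_add]
      map_smul' := hcomm }
  classical
  obtain ⟨r, hr⟩ := jacobson_density f
    (Finset.univ.image fun Q : ι → V => ρ.asModuleEquiv.symm (Pi.single Q 1))
  refine ⟨fun σ => r.coeff σ, fun P Q => ?_⟩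
  have h := hr _ (Finset.mem_image_of_mem _ (Finset.mem_univ Q))
  have h' := congrFun (congrArg ρ.asModuleEquiv h) P
  rw [Representation.asModuleEquiv_map_smul, Representation.asAlgebraHom_def,
    MonoidAlgebra.lift_apply, Finsupp.sum_fintype _ _ (by simp)] at h'
  simp only [f, LinearMap.coe_mk, AddHom.coe_mk, LinearEquiv.apply_symm_apply,
    Matrix.mulVec_single_one, LinearMap.sum_apply, LinearMap.smul_apply, Finset.sum_apply] at h'
  refine h'.trans (Finset.sum_congr rfl fun σ _ => ?_)
  simp [ρ, tensorPermRep_apply, Pi.single_apply]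

end KroneckerPower

section Contraction

variable {α V R : Type*} [Fintype α] [DecidableEq α] [Fintype V] [CommSemiring R]

theorem sum_prod_option_of_apply_none (A : Option α → Matrix V V R) {σ : Equiv.Perm (Option α)}
    (h : σ none = none) :
    ∑ I : Option α → V, ∏ a, A a (I a) (I (σ a)) =
      Matrix.trace (A none) *
        ∑ I : α → V, ∏ x, A (some x) (I x) (I (Equiv.removeNone σ x)) := by
  have hσ (x : α) : σ (some x) = some (Equiv.removeNone σ x) := by
    refine (Equiv.removeNone_some σ (Option.ne_none_iff_exists'.1 fun hx => ?_)).symm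
    simpa using σ.injective (hx.trans h.symm)
  rw [← (Equiv.piOptionEquivProd (β := fun _ : Option α => V)).symm.sum_comp,
    Fintype.sum_prod_type, Matrix.trace, Finset.sum_mul_sum]
  simp [Fintype.prod_option, h, hσ]

theorem sum_prod_option_of_apply_some (A : Option α → Matrix V V R) {σ : Equiv.Perm (Option α)}
    {c : α} (h : σ (some c) = none) :
    ∑ I : Option α → V, ∏ a, A a (I a) (I (σ a)) =
      ∑ I : α → V, ∏ x, (if x = c then A (some c) * A none else A (some x))
        (I x) (I (Equiv.removeNone σ x)) := by
  have hσ (x : α) (hx : x ≠ c) : σ (some x) = some (Equiv.removeNone σ x) := by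
    refine (Equiv.removeNone_some σ (Option.ne_none_iff_exists'.1 fun hx' => hx ?_)).symm
    simpa using σ.injective (hx'.trans h.symm)
  rw [← (Equiv.piOptionEquivProd (β := fun _ : Option α => V)).symm.sum_comp,
    Fintype.sum_prod_type_right]
  refine Finset.sum_congr rfl fun I _ => ?_
  rw [← Finset.mul_prod_erase _ _ (Finset.mem_univ c), if_pos rfl, Matrix.mul_apply,
    Finset.sum_mul]
  refine Finset.sum_congr rfl fun j _ => ?_
  rw [Fintype.prod_option, ← Finset.mul_prod_erase _ _ (Finset.mem_univ c),
    ← Equiv.removeNone_none σ h, h, ← mul_assoc, mul_comm (A none _ _)]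
  congr 1
  refine Finset.prod_congr rfl fun x hx => ?_
  have hx := Finset.ne_of_mem_erase hx
  rw [hσ x hx, if_neg hx]
  rfl

/-- Contracting words of generic matrices along a permutation yields a product of traces of words. -/
theorem exists_prod_traceWord_eq_sum_prod_perm {m n : ℕ} (ι : Type) [Fintype ι]
    [DecidableEq ι]    (σ : Equiv.Perm ι) (W : ι → List (Fin n)) (hW : ∀ a, W a ≠ []) :
    ∃ L : List (List (Fin n)), (∀ w ∈ L, w ≠ []) ∧
      (∀ i, (L.map fun w => w.count i).sum = ∑ a, (W a).count i) ∧
      (L.map (traceWord m n)).prod =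
        ∑ I : ι → Fin m, ∏ a, ((W a).map (genMat m n)).prod (I a) (I (σ a)) := by
  refine Fintype.induction_empty_option
    (P := fun ι _ => ∀ [DecidableEq ι] (σ : Equiv.Perm ι) (W : ι → List (Fin n)),
      (∀ a, W a ≠ []) → ∃ L : List (List (Fin n)), (∀ w ∈ L, w ≠ []) ∧
        (∀ i, (L.map fun w => w.count i).sum = ∑ a, (W a).count i) ∧
        (L.map (traceWord m n)).prod =
          ∑ I : ι → Fin m, ∏ a, ((W a).map (genMat m n)).prod (I a) (I (σ a)))
    ?_ ?_ ?_ ι σ W hW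
  · intro α β _ e ih dec σ W hW
    let := Fintype.ofEquiv β e.symm
    classical
    obtain ⟨L, h1, h2, h3⟩ := ih (e.trans (σ.trans e.symm)) (W ∘ e) fun a => hW _
    refine ⟨L, h1, fun i => ?_, ?_⟩
    · rw [h2, ← e.sum_comp]
      rfl
    · rw [h3, ← (e.arrowCongr (Equiv.refl (Fin m))).sum_comp]
      refine Finset.sum_congr rfl fun I _ => ?_
      rw [← e.prod_comp]
      simp
  · intro dec σ W hW
    exact ⟨[], by simp, by simp, by simp⟩
  · intro α _ ih dec σ W hW
    classical
    obtain rfl : dec = Option.instDecidableEq := Subsingleton.elim _ _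
    cases h : σ none with
    | none =>
      obtain ⟨L, h1, h2, h3⟩ := ih (Equiv.removeNone σ) (fun x => W (some x)) fun a => hW _
      refine ⟨W none :: L, by simpa [hW] using h1, fun i => by simp [h2], ?_⟩
      rw [sum_prod_option_of_apply_none (fun a => ((W a).map (genMat m n)).prod) h, ← h3]
      rfl
    | some b =>
      obtain ⟨c, hc⟩ : ∃ c, σ (some c) = none := by
        cases hc : σ.symm none with
        | none => simp [(σ.symm_apply_eq.1 hc).symm] at h
        | some c => exact ⟨c, by rw [← hc, σ.apply_symm_apply]⟩
      obtain ⟨L, h1, h2, h3⟩ := ih (Equiv.removeNone σ)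
        (fun x => if x = c then W (some c) ++ W none else W (some x)) fun a => by
          split_ifs <;> simp [hW]
      refine ⟨L, h1, fun i => ?_, ?_⟩
      · rw [h2, Fintype.sum_option, ← Finset.add_sum_erase _ _ (Finset.mem_univ c),
          ← Finset.add_sum_erase _ _ (Finset.mem_univ c), if_pos rfl, List.count_append,
          add_comm (List.count i (W (some c))), add_assoc]
        congr 2
        refine Finset.sum_congr rfl fun x hx => ?_
        rw [if_neg (Finset.ne_of_mem_erase hx)]
      · rw [sum_prod_option_of_apply_some (fun a => ((W a).map (genMat m n)).prod) hc, h3]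
        refine Finset.sum_congr rfl fun I _ => Finset.prod_congr rfl fun x _ => ?_
        split_ifs <;> simp

end Contraction

section TupleSum

variable {ι V K : Type*} [Fintype ι] [DecidableEq ι] [Fintype V]

/-- The polynomial with coefficient family `c` on the monomials `∏ a, X (F a)`. -/
noncomputable def tupleSum [CommSemiring K] (c : (ι → V) → K) : MvPolynomial V K :=
  ∑ F, MvPolynomial.C (c F) * ∏ a, MvPolynomial.X (F a)

theorem coeff_tupleSum [DecidableEq V] [CommSemiring K] (c : (ι → V) → K) (s : V →₀ ℕ) :
    (tupleSum c).coeff s = ∑ F with tupleExponent F = s, c F := by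
  simp [tupleSum, MvPolynomial.coeff_sum, prod_X_eq_monomial, MvPolynomial.coeff_C_mul,
    MvPolynomial.coeff_monomial, Finset.sum_filter]

theorem aeval_tupleSum [CommRing K] (M : Matrix V V K) (c : (ι → V) → K) :
    MvPolynomial.aeval (fun v => ∑ w, MvPolynomial.C (M v w) * MvPolynomial.X w) (tupleSum c) =
      tupleSum (Matrix.vecMul c (kroneckerPower ι M)) := by
  simp only [tupleSum, map_sum, map_mul, map_prod, MvPolynomial.aeval_X, MvPolynomial.aeval_C,
    Finset.prod_univ_sum, Fintype.piFinset_univ, Finset.mul_sum, Matrix.vecMul, dotProduct,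
    kroneckerPower, Matrix.of_apply, Finset.sum_mul, Finset.prod_mul_distrib]
  rw [Finset.sum_comm]
  simp only [MvPolynomial.algebraMap_eq, mul_assoc]

theorem sum_filter_tupleExponent_eq [DecidableEq V] [CommSemiring K] {c : (ι → V) → K}
    (hc : ∀ (σ : Equiv.Perm ι) F, c (F ∘ σ) = c F) (F : ι → V) :
    ∑ G with tupleExponent G = tupleExponent F, c G =
      (Finset.univ.filter fun G : ι → V => tupleExponent G = tupleExponent F).card • c F := by
  refine Finset.sum_eq_card_nsmul fun G hG => ?_
  obtain ⟨σ, rfl⟩ := exists_perm_of_tupleExponent_eq (Finset.mem_filter.1 hG).2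
  exact hc σ F

variable [Field K] [CharZero K]

theorem tupleSum_injective_of_symmetric {c c' : (ι → V) → K}
    (hc : ∀ (σ : Equiv.Perm ι) F, c (F ∘ σ) = c F)
    (hc' : ∀ (σ : Equiv.Perm ι) F, c' (F ∘ σ) = c' F)
    (h : tupleSum c = tupleSum c') : c = c' := by
  classical
  funext F
  have h := congrArg (MvPolynomial.coeff (tupleExponent F)) h
  rw [coeff_tupleSum, coeff_tupleSum, sum_filter_tupleExponent_eq hc, sum_filter_tupleExponent_eq hc'] at h
  refine smul_right_injective K (Finset.card_ne_zero_of_mem (a := F) ?_) h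
  simp

theorem exists_tupleSum_eq {d : ℕ} {f : MvPolynomial V K}
    (hf : ∀ s, f.coeff s ≠ 0 → s.degree = d) :
    ∃ c : (Fin d → V) → K, (∀ (σ : Equiv.Perm (Fin d)) F, c (F ∘ σ) = c F) ∧
      (∀ F, c F ≠ 0 → f.coeff (tupleExponent F) ≠ 0) ∧ tupleSum c = f := by
  classical
  let N (F : Fin d → V) : ℕ :=
    (Finset.univ.filter fun G : Fin d → V => tupleExponent G = tupleExponent F).card
  have hN (F : Fin d → V) : (N F : K) ≠ 0 :=
    Nat.cast_ne_zero.2 (Finset.card_ne_zero_of_mem (a := F) (by simp))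
  let c (F : Fin d → V) : K := f.coeff (tupleExponent F) / N F
  have hc (σ : Equiv.Perm (Fin d)) (F : Fin d → V) : c (F ∘ σ) = c F := by
    simp only [c, N, tupleExponent_comp_perm]
  refine ⟨c, hc, fun F hF h0 => hF (by simp [c, h0]), ?_⟩
  ext s
  rw [coeff_tupleSum]
  by_cases hs : ∃ F : Fin d → V, tupleExponent F = s
  · obtain ⟨F, rfl⟩ := hs
    rw [sum_filter_tupleExponent_eq hc, nsmul_eq_mul]
    exact mul_div_cancel₀ _ (hN F)
  · have h0 : f.coeff s = 0 := by
      by_contra h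
      exact hs (exists_tupleExponent_eq s (hf s h))
    rw [h0]
    exact Finset.sum_eq_zero fun F hF => (hs ⟨F, (Finset.mem_filter.1 hF).2⟩).elim

theorem vecMul_kroneckerPower_eq_of_aeval_eq {c : (ι → V) → K}
    (hc : ∀ (σ : Equiv.Perm ι) F, c (F ∘ σ) = c F) {M : Matrix V V K}
    (h : MvPolynomial.aeval (fun v => ∑ w, MvPolynomial.C (M v w) * MvPolynomial.X w)
      (tupleSum c) = tupleSum c) :
    Matrix.vecMul c (kroneckerPower ι M) = c := by
  rw [aeval_tupleSum] at h
  refine tupleSum_injective_of_symmetric (fun σ F => ?_) hc h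
  simp only [Matrix.vecMul, dotProduct]
  rw [← (σ.symm.arrowCongr (Equiv.refl V)).sum_comp]
  refine Finset.sum_congr rfl fun G _ => ?_
  have hG : (σ.symm.arrowCongr (Equiv.refl V)) G = G ∘ σ := by
    funext a
    simp
  rw [hG, hc]
  congr 1
  exact Equiv.prod_comp σ fun a => M (G a) (F a)

end TupleSum

section ConjInvariant

variable {m n d : ℕ}

/-- The coefficients of `c` on the monomials `∏ a, x^{k a}_{I a, J a}`, as a matrix indexed by
`(J, I)`. -/
def wordMatrix (c : (Fin d → Fin n × Fin m × Fin m) → ℂ) (k : Fin d → Fin n) :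
    Matrix (Fin d → Fin m) (Fin d → Fin m) ℂ :=
  Matrix.of fun J I => c fun a => (k a, I a, J a)

theorem sum_tuple_eq {M : Type*} [AddCommMonoid M] (φ : (Fin d → Fin n × Fin m × Fin m) → M) :
    ∑ F, φ F = ∑ k : Fin d → Fin n, ∑ J : Fin d → Fin m, ∑ I : Fin d → Fin m,
      φ fun a => (k a, I a, J a) := by
  let e : (Fin d → Fin n × Fin m × Fin m) ≃
      (Fin d → Fin n) × (Fin d → Fin m) × (Fin d → Fin m) :=
    { toFun F := (fun a => (F a).1, fun a => (F a).2.2, fun a => (F a).2.1)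
      invFun p a := (p.1 a, p.2.2 a, p.2.1 a)
      left_inv _ := rfl
      right_inv _ := rfl }
  rw [← e.symm.sum_comp, Fintype.sum_prod_type]
  simp only [Fintype.sum_prod_type]
  rfl

theorem commute_wordMatrix {c : (Fin d → Fin n × Fin m × Fin m) → ℂ}
    (hc : ∀ (σ : Equiv.Perm (Fin d)) F, c (F ∘ σ) = c F)
    (hinv : IsConjInvariant (tupleSum c)) (k : Fin d → Fin n)
    (g : Matrix (Fin m) (Fin m) ℂ) (hg : IsUnit g) :
    Commute (kroneckerPower (Fin d) g) (wordMatrix c k) := by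
  let M : Matrix (Fin n × Fin m × Fin m) (Fin n × Fin m × Fin m) ℂ :=
    Matrix.of fun v w => if v.1 = w.1 then g v.2.1 w.2.1 * g⁻¹ w.2.2 v.2.2 else 0
  have hM := vecMul_kroneckerPower_eq_of_aeval_eq hc (M := M) <| by
    refine Eq.trans ?_ (hinv g hg)
    congr 2
    funext v
    simp only [M, Fintype.sum_prod_type, Matrix.of_apply, Matrix.mul_apply, Matrix.map_apply, genMat,
      Finset.sum_mul]
    rw [Finset.sum_eq_single v.1 (by intro b _ hb; simp [hb.symm]) (by simp), Finset.sum_comm]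
    simp [mul_comm, mul_left_comm]
  have hunit := (Matrix.isUnit_iff_isUnit_det g).1 hg
  have key : kroneckerPower (Fin d) g⁻¹ * (wordMatrix c k * kroneckerPower (Fin d) g) =
      wordMatrix c k := by
    ext Q P
    have h := congrFun hM fun a => (k a, P a, Q a)
    simp only [Matrix.vecMul, dotProduct] at h
    rw [sum_tuple_eq, Finset.sum_eq_single k] at h
    · refine Eq.trans ?_ h
      rw [← mul_assoc]
      simp only [Matrix.mul_apply, kroneckerPower, wordMatrix, M, Finset.sum_mul,
        Matrix.of_apply, if_true, Finset.prod_mul_distrib]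
      rw [Finset.sum_comm]
      exact Finset.sum_congr rfl fun J _ => Finset.sum_congr rfl fun I _ => by ring
    · intro k' _ hk'
      obtain ⟨a, ha⟩ := Function.ne_iff.1 hk'
      refine Finset.sum_eq_zero fun J _ => Finset.sum_eq_zero fun I _ => ?_
      refine mul_eq_zero_of_right _ (Finset.prod_eq_zero (Finset.mem_univ a) ?_)
      simp [M, ha]
    · simp
  have h := congrArg (kroneckerPower (Fin d) g * ·) key
  simp only [← mul_assoc, ← kroneckerPower_mul, Matrix.mul_nonsing_inv g hunit,
    kroneckerPower_one, one_mul] at h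
  exact h.symm

end ConjInvariant

/-- **Invariants of matrices of a fixed multidegree** (Theorem 1.7): every
`GLₘ`-invariant polynomial in the entries of the generic matrices `X₁, …, Xₙ` which is
homogeneous of degree `dᵢ` in the entries of `Xᵢ` for each `i` is a ℂ-linear
combination of products of traces of words `Tr(X_{i₁}⋯X_{i_k})⋯Tr(X_{j₁}⋯X_{j_ℓ})`
in which the matrix `Xᵢ` occurs exactly `dᵢ` times in total, for each `i`. -/
theorem invariant_mem_span_traceProducts (m n : ℕ) (hm : 0 < m) (hn : 0 < n)
    (dv : Fin n → ℕ) (f : MvPolynomial (Fin n × Fin m × Fin m) ℂ)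
    (hdeg : ∀ i : Fin n,
      f.IsWeightedHomogeneous (fun v => if v.1 = i then 1 else 0) (dv i))
    (hinv : IsConjInvariant f) :
    f ∈ Submodule.span ℂ
      {p : MvPolynomial (Fin n × Fin m × Fin m) ℂ |
        ∃ L : List (List (Fin n)),
          (∀ w ∈ L, w ≠ []) ∧
          (∀ i : Fin n, (L.map fun w => w.count i).sum = dv i) ∧
          p = (L.map (traceWord m n)).prod} := by
  classical
  set d := ∑ i, dv i with hd
  have hcoeff (s) (hs : f.coeff s ≠ 0) (i : Fin n) :
      Finsupp.weight (fun v : Fin n × Fin m × Fin m => if v.1 = i then 1 else 0) s = dv i :=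
    hdeg i hs
  have hdegree (s) (hs : f.coeff s ≠ 0) : s.degree = d := by
    simp only [hd, ← hcoeff s hs, Finsupp.weight_apply, Finsupp.sum]
    rw [Finset.sum_comm]
    simp [Finsupp.degree_apply]
  obtain ⟨c, hc, hc0, rfl⟩ := exists_tupleSum_eq hdegree
  rw [tupleSum, sum_tuple_eq]
  refine Submodule.sum_mem _ fun k _ => ?_
  by_cases hk : ∀ i, (Finset.univ.filter fun a => k a = i).card = dv i
  · obtain ⟨r, hr⟩ := exists_eq_sum_perm_of_commute fun B hB =>
      commute_of_commute_kroneckerPower (commute_wordMatrix hc hinv k) hB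
    have hsum : (∑ J : Fin d → Fin m, ∑ I : Fin d → Fin m,
        MvPolynomial.C (c fun a => (k a, I a, J a)) *
          ∏ a, (MvPolynomial.X (k a, I a, J a) :
            MvPolynomial (Fin n × Fin m × Fin m) ℂ)) =
        ∑ σ, r σ • ∑ J : Fin d → Fin m,
          ∏ a, ([k a].map (genMat m n)).prod (J (σ a)) (J a) := by
      simp only [Finset.smul_sum]
      conv_rhs => rw [Finset.sum_comm]
      refine Finset.sum_congr rfl fun J _ => ?_
      have hcr (I : Fin d → Fin m) : c (fun a => (k a, I a, J a)) =
        ∑ σ : Equiv.Perm (Fin d), if J ∘ σ = I then r σ else 0 := hr J I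
      simp only [hcr, map_sum, Finset.sum_mul]
      rw [Finset.sum_comm]
      refine Finset.sum_congr rfl fun σ _ => ?_
      rw [Finset.sum_eq_single (J ∘ σ) (by intro I _ hI; simp [hI.symm]) (by simp)]
      simp [genMat, MvPolynomial.smul_eq_C_mul]
    rw [hsum]
    refine Submodule.sum_mem _ fun σ _ => Submodule.smul_mem _ _ (Submodule.subset_span ?_)
    obtain ⟨L, h1, h2, h3⟩ := exists_prod_traceWord_eq_sum_prod_perm (m := m) (Fin d) σ.symm
      (fun a => [k a]) (by simp)
    refine ⟨L, h1, fun i => ?_, ?_⟩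
    · rw [h2, ← hk i, Finset.card_filter]
      simp [List.count_singleton]
    · rw [h3, ← (σ.arrowCongr (Equiv.refl (Fin m))).sum_comp]
      refine Finset.sum_congr rfl fun I _ => ?_
      simp
  · refine Submodule.sum_mem _ fun J _ => Submodule.sum_mem _ fun I _ => ?_
    by_contra h
    have hne : c (fun a => (k a, I a, J a)) ≠ 0 := fun h0 => h (by simp [h0])
    refine hk fun i => ?_
    rw [← hcoeff _ (hc0 _ hne) i, tupleExponent, map_sum]
    simp [Finsupp.weight_single]
end

section
/- Let m, n, d be positive integers and let λ : [n]^d → ℂ be a family of coefficients indexed by words I = (i₁,…,i_d) of length d on the alphabet {1,…,n}. Then the following are equivalent: (1) the linear equation Σ_I λ_I x_I vanishes on hMPS(m,n,d), i.e. Σ_I λ_I Tr(X A_{i₁}⋯A_{i_d}) = 0 for all m×m complex matrices X, A₁,…,Aₙ; (2) Σ_I λ_I A_{i₁}⋯A_{i_d} = 0 (as an m×m matrix) for all m×m complex matrices A₁,…,Aₙ, i.e. the noncommutative polynomial Σ_I λ_I x_{i₁}⋯x_{i_d} is a polynomial identity for m×m matrices. -/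
/-- The product `A_{i₁} ⋯ A_{i_d}` of matrices along the word `I = (i₁, …, i_d)`. -/
noncomputable def wordProd {m n d : ℕ} (A : Fin n → Matrix (Fin m) (Fin m) ℂ)
    (I : Fin d → Fin n) : Matrix (Fin m) (Fin m) ℂ :=
  (List.ofFn fun j => A (I j)).prod

/-- **Linear equations on hMPS and polynomial identities** (the Observation): a linear
equation `Σ_I λ_I x_I` vanishes on `hMPS(m,n,d)`, i.e.
`Σ_I λ_I Tr(X·A_{i₁}⋯A_{i_d}) = 0` for all matrices `X, A₁, …, Aₙ`, if and only if
`Σ_I λ_I A_{i₁}⋯A_{i_d} = 0` for all matrices `A₁, …, Aₙ`, i.e. the noncommutative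
polynomial `Σ_I λ_I x_{i₁}⋯x_{i_d}` is a polynomial identity for `m × m` matrices. -/
theorem hMPS_linear_equations_iff_polynomial_identity (m n d : ℕ)
    (hm : 0 < m) (hn : 0 < n) (hd : 0 < d) (lam : (Fin d → Fin n) → ℂ) :
    (∀ (X : Matrix (Fin m) (Fin m) ℂ) (A : Fin n → Matrix (Fin m) (Fin m) ℂ),
        ∑ I : Fin d → Fin n, lam I * Matrix.trace (X * wordProd A I) = 0) ↔
      (∀ A : Fin n → Matrix (Fin m) (Fin m) ℂ,
        ∑ I : Fin d → Fin n, lam I • wordProd A I = 0) := by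
  have key (X : Matrix (Fin m) (Fin m) ℂ) (A : Fin n → Matrix (Fin m) (Fin m) ℂ) :
      ∑ I : Fin d → Fin n, lam I * Matrix.trace (X * wordProd A I) =
        Matrix.trace (X * ∑ I : Fin d → Fin n, lam I • wordProd A I) := by
    simp [Finset.mul_sum, Matrix.trace_sum]
  simp only [key]
  exact ⟨fun h A => Matrix.ext_iff_trace_mul_left.mpr fun X => by simpa using h X A,
    fun h X A => by simp [h A]⟩
end

section
/- Let m, n, d be positive integers. Then dim ⟨hMPS(m,n,d)⟩ + dim V_{id} = n^d, where ⟨hMPS(m,n,d)⟩ ⊆ (ℂⁿ)^{⊗d} is the linear span of hMPS(m,n,d), and V_{id} ⊆ ℂ^{[n]^d} is the linear space of all coefficient families λ : [n]^d → ℂ such that Σ_{I=(i₁,…,i_d)} λ_I A_{i₁}⋯A_{i_d} = 0 for all m×m complex matrices A₁,…,Aₙ (the space of multihomogeneous degree-d polynomial identities of m×m matrices in n variables). Equivalently, dim ⟨hMPS(m,n,d)⟩ equals the dimension of the degree-d homogeneous component of the ring of n generic m×m matrices. -/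
/-- The homogeneous matrix product state with boundary matrix `X` and matrices
`A₁, …, Aₙ`: the tensor with coordinates `Tr(X·A_{i₁}⋯A_{i_d})`. -/
noncomputable def hmpsState (m n d : ℕ) (X : Matrix (Fin m) (Fin m) ℂ)
    (A : Fin n → Matrix (Fin m) (Fin m) ℂ) : (Fin d → Fin n) → ℂ :=
  fun I => Matrix.trace (X * wordProd A I)

/-- The space `V_{id}` of coefficient families `λ : [n]^d → ℂ` such that
`Σ_I λ_I A_{i₁}⋯A_{i_d} = 0` for all `m × m` matrices `A₁, …, Aₙ` — the multilinear
(multihomogeneous degree-`d`) polynomial identities of `m × m` matrices in `n`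
variables. -/
noncomputable def idCoeffSpace (m n d : ℕ) : Submodule ℂ ((Fin d → Fin n) → ℂ) where
  carrier := {l | ∀ A : Fin n → Matrix (Fin m) (Fin m) ℂ,
    ∑ I : Fin d → Fin n, l I • wordProd A I = 0}
  add_mem' := by
    intro a b ha hb A
    simp only [Set.mem_setOf_eq] at ha hb
    simp only [Pi.add_apply, add_smul, Finset.sum_add_distrib, ha A, hb A, add_zero]
  zero_mem' := by
    intro A
    simp
  smul_mem' := by
    intro c a ha A
    simp only [Set.mem_setOf_eq] at ha
    simp only [Pi.smul_apply, smul_eq_mul, mul_smul, ← Finset.smul_sum, ha A, smul_zero]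

open Matrix in
/-- Pairing a coefficient family with a matrix product state gives the trace of `X` times the
evaluation of the corresponding noncommutative polynomial. -/
theorem dotProduct_hmpsState {m n d : ℕ} (l : (Fin d → Fin n) → ℂ)
    (X : Matrix (Fin m) (Fin m) ℂ) (A : Fin n → Matrix (Fin m) (Fin m) ℂ) :
    l ⬝ᵥ hmpsState m n d X A = (X * ∑ I, l I • wordProd A I).trace := by
  simp [dotProduct, hmpsState, Matrix.mul_sum, Matrix.trace_sum]

open Matrix in
/-- A coefficient family is a polynomial identity of `m × m` matrices iff it is orthogonal to
every homogeneous matrix product state. -/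
theorem mem_idCoeffSpace_iff {m n d : ℕ} (l : (Fin d → Fin n) → ℂ) :
    l ∈ idCoeffSpace m n d ↔ ∀ X A, l ⬝ᵥ hmpsState m n d X A = 0 := by
  change (∀ A : Fin n → Matrix (Fin m) (Fin m) ℂ, ∑ I, l I • wordProd A I = 0) ↔ _
  simp only [dotProduct_hmpsState, Matrix.ext_iff_trace_mul_left, mul_zero, Matrix.trace_zero]
  exact forall_comm

/-- Under the dot product, the space of identities is the annihilator of the span of the
homogeneous matrix product states. -/
theorem map_dotProductEquiv_idCoeffSpace (m n d : ℕ) :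
    (idCoeffSpace m n d).map (dotProductEquiv ℂ (Fin d → Fin n)).toLinearMap =
      (Submodule.span ℂ {T : (Fin d → Fin n) → ℂ |
        ∃ (X : Matrix (Fin m) (Fin m) ℂ) (A : Fin n → Matrix (Fin m) (Fin m) ℂ),
          T = hmpsState m n d X A}).dualAnnihilator := by
  ext φ
  obtain ⟨l, rfl⟩ := (dotProductEquiv ℂ (Fin d → Fin n)).surjective φ
  rw [Submodule.mem_map_equiv, LinearEquiv.symm_apply_apply, mem_idCoeffSpace_iff,
    ← SetLike.mem_coe, Submodule.coe_dualAnnihilator_span]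
  constructor
  · rintro h _ ⟨X, A, rfl⟩
    exact h X A
  · exact fun h X A => h ⟨X, A, rfl⟩

/-- **Dimension of the linear span of `hMPS(m,n,d)`**: the span of the homogeneous
matrix product states and the space of multihomogeneous degree-`d` polynomial
identities of `m × m` matrices have complementary dimensions in `(ℂⁿ)^⊗d`;
equivalently, `dim ⟨hMPS(m,n,d)⟩` equals the dimension of the degree-`d` component of
the ring of `n` generic `m × m` matrices. -/
theorem finrank_span_hMPS_add_finrank_idCoeffSpace (m n d : ℕ)
    (hm : 0 < m) (hn : 0 < n) (hd : 0 < d) :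
    Module.finrank ℂ
        ↥(Submodule.span ℂ {T : (Fin d → Fin n) → ℂ |
            ∃ (X : Matrix (Fin m) (Fin m) ℂ) (A : Fin n → Matrix (Fin m) (Fin m) ℂ),
              T = hmpsState m n d X A})
      + Module.finrank ℂ ↥(idCoeffSpace m n d) = n ^ d := by
  rw [← LinearEquiv.finrank_map_eq (dotProductEquiv ℂ (Fin d → Fin n)) (idCoeffSpace m n d),
    map_dotProductEquiv_idCoeffSpace,
    Subspace.finrank_add_finrank_dualAnnihilator_eq]
  simp
end

section
/- For every natural number d, the dimension of the linear span of hMPS(2,2,d) inside (ℂ²)^{⊗d} is (d⁴ + 4d³ + 2d² + 44d + 48)/48 if d is even, and (d⁴ + 4d³ + 2d² + 44d + 45)/48 if d is odd. -/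
/-- The span of the ordered monomials `X ^ i * Y ^ (n - i)`. -/
noncomputable def orderedSpan {R : Type*} [Ring R] [Algebra ℂ R] (X Y : R) (n : ℕ) :
    Submodule ℂ R :=
  Submodule.span ℂ (Set.range fun i : Fin (n + 1) => X ^ (i : ℕ) * Y ^ (n - i))

/-- Relations between the half-traces `t`, `u` and the traceless parts `x`, `y` of two generic
`2 × 2` matrices. -/
structure IsGenericPair {R : Type*} [Ring R] (t u x y : R) : Prop where
  comm_t : ∀ z, Commute t z
  comm_u : ∀ z, Commute u z
  comm_x : ∀ z, Commute (x * x) z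
  comm_y : ∀ z, Commute (y * y) z
  comm_xy : ∀ z, Commute (x * y + y * x) z

/-- The span of `t`, `u`, `x`, `y`; its powers are the graded parts of the algebra they generate. -/
noncomputable def genSpan {R : Type*} [Ring R] [Algebra ℂ R] (t u x y : R) : Submodule ℂ R :=
  Submodule.span ℂ {t, u, x, y}

/-- The degree `n` part of the commutator ideal of the algebra generated by `t + x` and `u + y`. -/
noncomputable def commSpan {R : Type*} [Ring R] [Algebra ℂ R] (t u x y : R) : ℕ → Submodule ℂ R
  | 0 => ⊥
  | 1 => ⊥
  | n + 2 => genSpan t u x y ^ n * Submodule.span ℂ {x * y - y * x}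

/-- The ordered monomial with exponents `m` in `t`, `u`, `x`, `y` and `k` in `x * y + y * x`. -/
def genMonomial {R : Type*} [Ring R] (t u x y : R) (k : ℕ) (m : Fin 4 →₀ ℕ) : R :=
  t ^ m 0 * u ^ m 1 * x ^ m 2 * y ^ m 3 * (x * y + y * x) ^ k

/-- Exponents of the ordered monomials of degree `n`. -/
def genIndex (n : ℕ) : Finset (Σ _ : ℕ, Fin 4 →₀ ℕ) :=
  (Finset.range (n / 2 + 1)).sigma fun k => (Finset.univ : Finset (Fin 4)).finsuppAntidiag (n - 2 * k)

theorem mem_genIndex {n : ℕ} {p : Σ _ : ℕ, Fin 4 →₀ ℕ} :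
    p ∈ genIndex n ↔ p.2 0 + p.2 1 + p.2 2 + p.2 3 + 2 * p.1 = n := by
  simp only [genIndex, Finset.mem_sigma, Finset.mem_range, Finset.mem_finsuppAntidiag,
    Finset.subset_univ, and_true, Fin.sum_univ_four]
  omega

namespace IsGenericPair

variable {R : Type*} [Ring R] {t u x y : R}

theorem comm_mul_x (h : IsGenericPair t u x y) :
    (x * y - y * x) * x = -(x * (x * y - y * x)) := by
  linear_combination (norm := noncomm_ring) (h.comm_x y).eq

theorem comm_mul_y (h : IsGenericPair t u x y) :
    (x * y - y * x) * y = -(y * (x * y - y * x)) := by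
  linear_combination (norm := noncomm_ring) -(h.comm_y x).eq

theorem comm_mul_add_x (h : IsGenericPair t u x y) :
    (x * y - y * x) * (t + x) = (t - x) * (x * y - y * x) := by
  rw [mul_add, sub_mul t, h.comm_mul_x, (h.comm_t _).eq, ← sub_eq_add_neg]

theorem comm_mul_add_y (h : IsGenericPair t u x y) :
    (x * y - y * x) * (u + y) = (u - y) * (x * y - y * x) := by
  rw [mul_add, sub_mul u, h.comm_mul_y, (h.comm_u _).eq, ← sub_eq_add_neg]

variable [Algebra ℂ R]

theorem add_x_mem : t + x ∈ genSpan t u x y :=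
  add_mem (Submodule.subset_span (by simp)) (Submodule.subset_span (by simp))

theorem add_y_mem : u + y ∈ genSpan t u x y :=
  add_mem (Submodule.subset_span (by simp)) (Submodule.subset_span (by simp))

theorem genSpan_mul_commSpan_le (n : ℕ) :
    genSpan t u x y * commSpan t u x y n ≤ commSpan t u x y (n + 1) := by
  match n with
  | 0 => simp [commSpan]
  | 1 => simp [commSpan]
  | n + 2 =>
    simp only [commSpan]
    rw [← mul_assoc, ← pow_succ']

theorem comm_mul_genSpan_le (h : IsGenericPair t u x y) :
    Submodule.span ℂ {x * y - y * x} * genSpan t u x y ≤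
      genSpan t u x y * Submodule.span ℂ {x * y - y * x} := by
  have key : ∀ g ∈ genSpan t u x y, g * (x * y - y * x) ∈
      genSpan t u x y * Submodule.span ℂ {x * y - y * x} := fun g hg =>
    Submodule.mul_mem_mul hg (Submodule.mem_span_singleton_self _)
  rw [genSpan, Submodule.span_mul_span, Submodule.span_le]
  rintro _ ⟨_, rfl, g, hg, rfl⟩
  simp only [Set.mem_insert_iff, Set.mem_singleton_iff] at hg
  simp only [SetLike.mem_coe]
  rcases hg with rfl | rfl | rfl | rfl
  · rw [← (h.comm_t _).eq]
    exact key _ (Submodule.subset_span (by simp))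
  · rw [← (h.comm_u _).eq]
    exact key _ (Submodule.subset_span (by simp))
  · rw [h.comm_mul_x]
    exact neg_mem (key _ (Submodule.subset_span (by simp)))
  · rw [h.comm_mul_y]
    exact neg_mem (key _ (Submodule.subset_span (by simp)))

theorem commSpan_mul_genSpan_le (h : IsGenericPair t u x y) (n : ℕ) :
    commSpan t u x y n * genSpan t u x y ≤ commSpan t u x y (n + 1) := by
  match n with
  | 0 => simp [commSpan]
  | 1 => simp [commSpan]
  | n + 2 =>
    simp only [commSpan]
    rw [mul_assoc, pow_succ, mul_assoc]
    exact mul_le_mul_right h.comm_mul_genSpan_le _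

theorem commSpan_mul_pow_mem (h : IsGenericPair t u x y) {n : ℕ} {a b : R}
    (ha : a ∈ commSpan t u x y n) (hb : b ∈ genSpan t u x y) (j : ℕ) :
    a * b ^ j ∈ commSpan t u x y (n + j) := by
  induction j with
  | zero => simpa using ha
  | succ j ih =>
    rw [pow_succ, ← mul_assoc]
    exact h.commSpan_mul_genSpan_le _ (Submodule.mul_mem_mul ih hb)

theorem mul_pow_sub_mem (h : IsGenericPair t u x y) (i : ℕ) :
    (u + y) * (t + x) ^ i - (t + x) ^ i * (u + y) ∈ commSpan t u x y (i + 1) := by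
  induction i with
  | zero => simp
  | succ i ih =>
    have e : (u + y) * (t + x) ^ (i + 1) - (t + x) ^ (i + 1) * (u + y) =
        ((u + y) * (t + x) ^ i - (t + x) ^ i * (u + y)) * (t + x)
          - (t + x) ^ i * (x * y - y * x) := by
      have e1 : (u + y) * (t + x) - (t + x) * (u + y) = - (x * y - y * x) := by
        linear_combination (norm := noncomm_ring) (h.comm_u (t + x)).eq - (h.comm_t y).eq
      rw [pow_succ]
      linear_combination (norm := noncomm_ring) (t + x) ^ i * e1
    rw [e]
    refine sub_mem (h.commSpan_mul_genSpan_le _ (Submodule.mul_mem_mul ih add_x_mem)) ?_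
    exact Submodule.mul_mem_mul (Submodule.pow_mem_pow _ add_x_mem _)
      (Submodule.mem_span_singleton_self _)

theorem pow_le_sup (h : IsGenericPair t u x y) (n : ℕ) :
    Submodule.span ℂ {t + x, u + y} ^ n ≤
      orderedSpan (t + x) (u + y) n ⊔ commSpan t u x y n := by
  induction n with
  | zero =>
    refine le_trans ?_ le_sup_left
    rw [pow_zero, Submodule.one_eq_span, orderedSpan]
    exact Submodule.span_mono (by simp)
  | succ n ih =>
    rw [pow_succ']
    refine (mul_le_mul_right ih _).trans ?_
    rw [Submodule.mul_sup]
    refine sup_le ?_ ?_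
    · rw [orderedSpan, Submodule.span_mul_span, Submodule.span_le]
      rintro _ ⟨g, hg, _, ⟨⟨i, hi⟩, rfl⟩, rfl⟩
      have mem : ∀ j ≤ n + 1, (t + x) ^ j * (u + y) ^ (n + 1 - j) ∈
          orderedSpan (t + x) (u + y) (n + 1) := fun j hj =>
        Submodule.subset_span ⟨⟨j, by omega⟩, rfl⟩
      simp only [Set.mem_insert_iff, Set.mem_singleton_iff] at hg
      simp only [SetLike.mem_coe]
      rcases hg with rfl | rfl
      · refine Submodule.mem_sup_left ?_
        have := mem (i + 1) (by omega)
        rwa [pow_succ', mul_assoc, show n + 1 - (i + 1) = n - i by omega] at this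
      · have e : (u + y) * ((t + x) ^ i * (u + y) ^ (n - i)) =
            (t + x) ^ i * (u + y) ^ (n + 1 - i) +
            ((u + y) * (t + x) ^ i - (t + x) ^ i * (u + y)) * (u + y) ^ (n - i) := by
          rw [show n + 1 - i = n - i + 1 by omega, pow_succ']
          noncomm_ring
        rw [e]
        refine Submodule.add_mem_sup (mem i (by omega)) ?_
        have := h.commSpan_mul_pow_mem (h.mul_pow_sub_mem i) add_y_mem (n - i)
        rwa [show i + 1 + (n - i) = n + 1 by omega] at this
    · refine le_trans (le_trans ?_ (genSpan_mul_commSpan_le n)) le_sup_right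
      refine mul_le_mul_left (Submodule.span_le.2 ?_) _
      rintro g (rfl | rfl)
      exacts [add_x_mem, add_y_mem]

theorem orderedSpan_le (X Y : R) (n : ℕ) : orderedSpan X Y n ≤ Submodule.span ℂ {X, Y} ^ n := by
  rw [orderedSpan, Submodule.span_le]
  rintro _ ⟨⟨i, hi⟩, rfl⟩
  have := Submodule.mul_mem_mul
    (Submodule.pow_mem_pow _ (Submodule.subset_span (s := {X, Y}) (R := ℂ) (by simp) : X ∈ _) i)
    (Submodule.pow_mem_pow _ (Submodule.subset_span (s := {X, Y}) (R := ℂ) (by simp) : Y ∈ _) (n - i))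
  rwa [← pow_add, show i + (n - i) = n by omega] at this

theorem u_pow_mul_mem (h : IsGenericPair t u x y) (q : ℕ) : ∀ (m : ℕ),
    ∀ w ∈ Submodule.span ℂ {t + x, u + y} ^ m,
    u ^ q * (w * (x * y - y * x)) ∈ Submodule.span ℂ {t + x, u + y} ^ (q + m + 2) := by
  set V := Submodule.span ℂ {t + x, u + y} with hV
  have hX : t + x ∈ V := Submodule.subset_span (by simp)
  have hY : u + y ∈ V := Submodule.subset_span (by simp)
  induction q with
  | zero =>
    intro m w hw
    have e : x * y - y * x = (t + x) * (u + y) - (u + y) * (t + x) := by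
      linear_combination (norm := noncomm_ring) (h.comm_u (t + x)).eq - (h.comm_t y).eq
    rw [pow_zero, one_mul, zero_add, pow_add, e, pow_two]
    exact Submodule.mul_mem_mul hw
      (sub_mem (Submodule.mul_mem_mul hX hY) (Submodule.mul_mem_mul hY hX))
  | succ q ih =>
    intro m w hw
    have e : u ^ (q + 1) * (w * (x * y - y * x)) =
        (1 / 2 : ℂ) • (u ^ q * (w * (x * y - y * x)) * (u + y) +
          u ^ q * (w * (u + y) * (x * y - y * x))) := by
      have e1 : u ^ q * (w * (x * y - y * x)) * (u + y) +
          u ^ q * (w * (u + y) * (x * y - y * x)) =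
          (2 : ℂ) • (u ^ (q + 1) * (w * (x * y - y * x))) := by
        rw [two_smul, pow_succ]
        linear_combination (norm := noncomm_ring) u ^ q * w * h.comm_mul_add_y
          - 2 * (u ^ q * (h.comm_u w).eq * (x * y - y * x))
      rw [e1, smul_smul]
      norm_num
    rw [e]
    refine Submodule.smul_mem _ _ (add_mem ?_ ?_)
    · rw [show q + 1 + m + 2 = q + m + 2 + 1 by ring, pow_succ V]
      exact Submodule.mul_mem_mul (ih m w hw) hY
    · rw [show q + 1 + m + 2 = q + (m + 1) + 2 by ring]
      exact ih (m + 1) _ (by rw [pow_succ]; exact Submodule.mul_mem_mul hw hY)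

theorem t_pow_mul_mem (h : IsGenericPair t u x y) (q : ℕ) (p : ℕ) : ∀ (m : ℕ),
    ∀ w ∈ Submodule.span ℂ {t + x, u + y} ^ m,
    t ^ p * (u ^ q * (w * (x * y - y * x))) ∈
      Submodule.span ℂ {t + x, u + y} ^ (p + q + m + 2) := by
  set V := Submodule.span ℂ {t + x, u + y} with hV
  have hX : t + x ∈ V := Submodule.subset_span (by simp)
  induction p with
  | zero =>
    intro m w hw
    simpa using h.u_pow_mul_mem q m w hw
  | succ p ih =>
    intro m w hw
    have e : t ^ (p + 1) * (u ^ q * (w * (x * y - y * x))) =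
        (1 / 2 : ℂ) • (t ^ p * (u ^ q * (w * (x * y - y * x))) * (t + x) +
          t ^ p * (u ^ q * (w * (t + x) * (x * y - y * x)))) := by
      have e1 : t ^ p * (u ^ q * (w * (x * y - y * x))) * (t + x) +
          t ^ p * (u ^ q * (w * (t + x) * (x * y - y * x))) =
          (2 : ℂ) • (t ^ (p + 1) * (u ^ q * (w * (x * y - y * x)))) := by
        rw [two_smul, pow_succ]
        linear_combination (norm := noncomm_ring) t ^ p * u ^ q * w * h.comm_mul_add_x
          - 2 * (t ^ p * (h.comm_t (u ^ q * w)).eq * (x * y - y * x))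
      rw [e1, smul_smul]
      norm_num
    rw [e]
    refine Submodule.smul_mem _ _ (add_mem ?_ ?_)
    · rw [show p + 1 + q + m + 2 = p + q + m + 2 + 1 by ring, pow_succ V]
      exact Submodule.mul_mem_mul (ih m w hw) hX
    · rw [show p + 1 + q + m + 2 = p + q + (m + 1) + 2 by ring]
      exact ih (m + 1) _ (by rw [pow_succ]; exact Submodule.mul_mem_mul hw hX)

theorem pow_mul_genSpan_mem (h : IsGenericPair t u x y) (n : ℕ) : ∀ (p q : ℕ),
    ∀ a ∈ genSpan t u x y ^ n, t ^ p * (u ^ q * (a * (x * y - y * x))) ∈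
      Submodule.span ℂ {t + x, u + y} ^ (p + q + n + 2) := by
  set V := Submodule.span ℂ {t + x, u + y} with hV
  have hX : t + x ∈ V := Submodule.subset_span (by simp)
  have hY : u + y ∈ V := Submodule.subset_span (by simp)
  induction n with
  | zero =>
    intro p q a ha
    exact h.t_pow_mul_mem q p 0 a ha
  | succ n ih =>
    intro p q a ha
    rw [pow_succ'] at ha
    induction ha using Submodule.mul_induction_on' with
    | add a _ b _ ha hb =>
      rw [add_mul, mul_add, mul_add]
      exact add_mem ha hb
    | mem_mul_mem g hg a ha =>
      rw [genSpan] at hg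
      have ht : t ^ p * (u ^ q * (t * a * (x * y - y * x))) ∈ V ^ (p + q + (n + 1) + 2) := by
        have e : t ^ p * (u ^ q * (t * a * (x * y - y * x))) =
            t ^ (p + 1) * (u ^ q * (a * (x * y - y * x))) := by
          rw [pow_succ, mul_assoc (t ^ p), ← mul_assoc t (u ^ q), (h.comm_t (u ^ q)).eq]
          simp only [mul_assoc]
        rw [e, show p + q + (n + 1) + 2 = p + 1 + q + n + 2 by ring]
        exact ih (p + 1) q a ha
      have hu : t ^ p * (u ^ q * (u * a * (x * y - y * x))) ∈ V ^ (p + q + (n + 1) + 2) := by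
        have e : t ^ p * (u ^ q * (u * a * (x * y - y * x))) =
            t ^ p * (u ^ (q + 1) * (a * (x * y - y * x))) := by
          rw [pow_succ]
          simp only [mul_assoc]
        rw [e, show p + q + (n + 1) + 2 = p + (q + 1) + n + 2 by ring]
        exact ih p (q + 1) a ha
      have hleft : ∀ z ∈ V, t ^ p * (u ^ q * (z * a * (x * y - y * x))) ∈
          V ^ (p + q + (n + 1) + 2) := by
        intro z hz
        have e : t ^ p * (u ^ q * (z * a * (x * y - y * x))) =
            z * (t ^ p * (u ^ q * (a * (x * y - y * x)))) := by
          have c := (((h.comm_t z).pow_left p).mul_left ((h.comm_u z).pow_left q)).eq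
          simp only [← mul_assoc] at c ⊢
          rw [c]
        rw [e, show p + q + (n + 1) + 2 = p + q + n + 2 + 1 by ring, pow_succ' V]
        exact Submodule.mul_mem_mul hz (ih p q a ha)
      induction hg using Submodule.span_induction with
      | zero => simp
      | add g g' _ _ hg hg' =>
        rw [add_mul, add_mul, mul_add, mul_add]
        exact add_mem hg hg'
      | smul c g _ hg =>
        simp only [smul_mul_assoc, mul_smul_comm]
        exact Submodule.smul_mem _ _ hg
      | mem g hg =>
        simp only [Set.mem_insert_iff, Set.mem_singleton_iff] at hg
        rcases hg with rfl | rfl | rfl | rfl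
        · exact ht
        · exact hu
        · have := sub_mem (hleft _ hX) ht
          rwa [← mul_sub, ← mul_sub, ← sub_mul, ← sub_mul, add_sub_cancel_left] at this
        · have := sub_mem (hleft _ hY) hu
          rwa [← mul_sub, ← mul_sub, ← sub_mul, ← sub_mul, add_sub_cancel_left] at this

theorem commSpan_le (h : IsGenericPair t u x y) (n : ℕ) :
    commSpan t u x y n ≤ Submodule.span ℂ {t + x, u + y} ^ n := by
  match n with
  | 0 => simp [commSpan]
  | 1 => simp [commSpan]
  | n + 2 =>
    rw [commSpan, Submodule.mul_le]
    intro a ha b hb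
    obtain ⟨c, rfl⟩ := Submodule.mem_span_singleton.1 hb
    rw [mul_smul_comm]
    refine Submodule.smul_mem _ _ ?_
    simpa using h.pow_mul_genSpan_mem n 0 0 a ha

theorem span_pow_eq (h : IsGenericPair t u x y) (n : ℕ) :
    Submodule.span ℂ {t + x, u + y} ^ n =
      orderedSpan (t + x) (u + y) n ⊔ commSpan t u x y n :=
  le_antisymm (h.pow_le_sup n) (sup_le (orderedSpan_le _ _ n) (h.commSpan_le n))

theorem genSpan_pow_eq (h : IsGenericPair t u x y) (n : ℕ) :
    genSpan t u x y ^ n =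
      Submodule.span ℂ (Set.range fun p : genIndex n => genMonomial t u x y p.1.1 p.1.2) := by
  set M : ℕ → Submodule ℂ R := fun n =>
    Submodule.span ℂ (Set.range fun p : genIndex n => genMonomial t u x y p.1.1 p.1.2) with hM
  have mem : ∀ a b i j k n, a + b + i + j + 2 * k = n →
      t ^ a * u ^ b * x ^ i * y ^ j * (x * y + y * x) ^ k ∈ M n := by
    intro a b i j k n hn
    refine Submodule.subset_span
      ⟨⟨⟨k, Finsupp.equivFunOnFinite.symm ![a, b, i, j]⟩, mem_genIndex.2 ?_⟩, ?_⟩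
    · simpa using hn
    · simp [genMonomial]
  have extend : ∀ g, (∀ a b i j k n, a + b + i + j + 2 * k = n →
      g * (t ^ a * u ^ b * x ^ i * y ^ j * (x * y + y * x) ^ k) ∈ M (n + 1)) →
      ∀ n, ∀ z ∈ M n, g * z ∈ M (n + 1) := by
    intro g hg n z hz
    induction hz using Submodule.span_induction with
    | zero => simp
    | add z w _ _ hz hw => rw [mul_add]; exact add_mem hz hw
    | smul c z _ hz => rw [mul_smul_comm]; exact Submodule.smul_mem _ _ hz
    | mem z hz =>
      obtain ⟨⟨p, hp⟩, rfl⟩ := hz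
      exact hg _ _ _ _ _ _ (mem_genIndex.1 hp)
  have ht := extend t fun a b i j k n hn => by
    have := mem (a + 1) b i j k (n + 1) (by omega)
    rw [pow_succ'] at this
    simpa only [mul_assoc] using this
  have hu := extend u fun a b i j k n hn => by
    have := mem a (b + 1) i j k (n + 1) (by omega)
    rw [pow_succ', ← mul_assoc (t ^ a), ← (h.comm_u (t ^ a)).eq] at this
    simpa only [mul_assoc] using this
  have hx := extend x fun a b i j k n hn => by
    have := mem a b (i + 1) j k (n + 1) (by omega)
    rw [pow_succ', ← mul_assoc (t ^ a * u ^ b),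
      (((h.comm_t x).pow_left a).mul_left ((h.comm_u x).pow_left b)).eq] at this
    simpa only [mul_assoc] using this
  have hy := extend y fun a b i => by
    induction i with
    | zero =>
      intro j k n hn
      have := mem a b 0 (j + 1) k (n + 1) (by omega)
      rw [pow_zero, mul_one, pow_succ', ← mul_assoc (t ^ a * u ^ b),
        (((h.comm_t y).pow_left a).mul_left ((h.comm_u y).pow_left b)).eq] at this
      simpa only [mul_assoc, pow_zero, one_mul] using this
    | succ i ih =>
      intro j k n hn
      have e : y * (t ^ a * u ^ b * x ^ (i + 1) * y ^ j * (x * y + y * x) ^ k) =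
          t ^ a * u ^ b * x ^ i * y ^ j * (x * y + y * x) ^ (k + 1) -
          x * (y * (t ^ a * u ^ b * x ^ i * y ^ j * (x * y + y * x) ^ k)) := by
        have c : ∀ z, t ^ a * u ^ b * z = z * (t ^ a * u ^ b) := fun z =>
          (((h.comm_t z).pow_left a).mul_left ((h.comm_u z).pow_left b)).eq
        have c' := (h.comm_xy (t ^ a * u ^ b * x ^ i * y ^ j)).eq
        rw [pow_succ' _ k, ← mul_assoc (t ^ a * u ^ b * x ^ i * y ^ j), ← c', pow_succ',
          ← mul_assoc (t ^ a * u ^ b) x, c x]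
        noncomm_ring
      rw [e]
      refine sub_mem (mem a b i j (k + 1) (n + 1) (by omega)) ?_
      obtain ⟨n, rfl⟩ : ∃ n', n = n' + 1 := ⟨n - 1, by omega⟩
      exact hx _ _ (ih j k n (by omega))
  refine le_antisymm ?_ ?_
  · change _ ≤ M n
    induction n with
    | zero =>
      rw [pow_zero, Submodule.one_le]
      simpa using mem 0 0 0 0 0 0 rfl
    | succ n ih =>
      rw [pow_succ']
      refine (mul_le_mul_right ih _).trans (Submodule.mul_le.2 fun g hg z hz => ?_)
      induction hg using Submodule.span_induction with
      | zero => simp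
      | add g g' _ _ hg hg' => rw [add_mul]; exact add_mem hg hg'
      | smul c g _ hg => rw [smul_mul_assoc]; exact Submodule.smul_mem _ _ hg
      | mem g hg =>
        simp only [Set.mem_insert_iff, Set.mem_singleton_iff] at hg
        rcases hg with rfl | rfl | rfl | rfl
        exacts [ht n z hz, hu n z hz, hx n z hz, hy n z hz]
  · rw [Submodule.span_le]
    rintro _ ⟨⟨p, hp⟩, rfl⟩
    have ht : t ∈ genSpan t u x y := Submodule.subset_span (by simp)
    have hu : u ∈ genSpan t u x y := Submodule.subset_span (by simp)
    have hx : x ∈ genSpan t u x y := Submodule.subset_span (by simp)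
    have hy : y ∈ genSpan t u x y := Submodule.subset_span (by simp)
    have he : x * y + y * x ∈ genSpan t u x y ^ 2 := by
      rw [pow_two]
      exact add_mem (Submodule.mul_mem_mul hx hy) (Submodule.mul_mem_mul hy hx)
    have := Submodule.mul_mem_mul (Submodule.mul_mem_mul (Submodule.mul_mem_mul
      (Submodule.mul_mem_mul (Submodule.pow_mem_pow _ ht (p.2 0)) (Submodule.pow_mem_pow _ hu (p.2 1)))
      (Submodule.pow_mem_pow _ hx (p.2 2))) (Submodule.pow_mem_pow _ hy (p.2 3)))
      (Submodule.pow_mem_pow _ he p.1)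
    rwa [← pow_mul, ← pow_add, ← pow_add, ← pow_add, ← pow_add, mem_genIndex.1 hp] at this

theorem commSpan_eq (h : IsGenericPair t u x y) (n : ℕ) :
    commSpan t u x y (n + 2) = Submodule.span ℂ (Set.range fun p : genIndex n =>
      genMonomial t u x y p.1.1 p.1.2 * (x * y - y * x)) := by
  rw [commSpan, h.genSpan_pow_eq, Submodule.span_mul_span, Set.mul_singleton, ← Set.range_comp]
  rfl

end IsGenericPair

/-- Matrix-valued functions of a pair of `2 × 2` matrices. -/
abbrev MatFun : Type := (Fin 2 → Matrix (Fin 2) (Fin 2) ℂ) → Matrix (Fin 2) (Fin 2) ℂ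

/-- The generic matrix `A i`. -/
def genericMatrix (i : Fin 2) : MatFun := fun A => A i

/-- The scalar matrix with the same trace as `A i`. -/
noncomputable def halfTrace (i : Fin 2) : MatFun := fun A => ((A i).trace / 2) • 1

/-- The traceless part of `A i`. -/
noncomputable def tracelessPart (i : Fin 2) : MatFun := genericMatrix i - halfTrace i

theorem halfTrace_add_tracelessPart (i : Fin 2) :
    halfTrace i + tracelessPart i = genericMatrix i := by
  simp [tracelessPart]

theorem isGenericPair_matFun :
    IsGenericPair (halfTrace 0) (halfTrace 1) (tracelessPart 0) (tracelessPart 1) := by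
  constructor <;> intro z <;> funext A <;> ext i j <;> fin_cases i <;> fin_cases j <;>
    simp [halfTrace, tracelessPart, genericMatrix, Matrix.mul_apply, Fin.sum_univ_two,
      Matrix.trace, Matrix.one_apply] <;> ring

/-- Upper triangular traceless `x` and lower triangular traceless `y`, shifted by scalars,
with `x * y + y * x` the scalar `s 0`. -/
noncomputable def testPair (s : Fin 5 → ℂ) : Fin 2 → Matrix (Fin 2) (Fin 2) ℂ :=
  ![!![s 1 - s 3, 1; 0, s 1 + s 3], !![s 2 - s 4, 0; s 0 - 2 * s 3 * s 4, s 2 + s 4]]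

theorem halfTrace_zero_testPair (s : Fin 5 → ℂ) : halfTrace 0 (testPair s) = s 1 • 1 := by
  simp only [halfTrace, testPair, Matrix.trace, Matrix.cons_val_zero, Fin.sum_univ_two]
  congr 1
  simp

theorem halfTrace_one_testPair (s : Fin 5 → ℂ) : halfTrace 1 (testPair s) = s 2 • 1 := by
  simp only [halfTrace, testPair, Matrix.trace, Matrix.cons_val_one, Fin.sum_univ_two]
  congr 1
  simp

theorem tracelessPart_zero_testPair (s : Fin 5 → ℂ) :
    tracelessPart 0 (testPair s) = !![-s 3, 1; 0, s 3] := by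
  rw [tracelessPart, Pi.sub_apply, halfTrace_zero_testPair]
  ext i j
  fin_cases i <;> fin_cases j <;> simp [genericMatrix, testPair]

theorem tracelessPart_one_testPair (s : Fin 5 → ℂ) :
    tracelessPart 1 (testPair s) = !![-s 4, 0; s 0 - 2 * s 3 * s 4, s 4] := by
  rw [tracelessPart, Pi.sub_apply, halfTrace_one_testPair]
  ext i j
  fin_cases i <;> fin_cases j <;> simp [genericMatrix, testPair]

theorem pow_apply_of_row {a b r : ℂ} (n : ℕ) :
    (!![a, b; 0, r] ^ n) 1 0 = 0 ∧ (!![a, b; 0, r] ^ n) 1 1 = r ^ n := by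
  induction n with
  | zero => simp
  | succ n ih => simp [pow_succ, Matrix.mul_apply, Fin.sum_univ_two, ih.1, ih.2]

theorem pow_apply_of_col {a b r : ℂ} (n : ℕ) :
    (!![a, 0; b, r] ^ n) 0 1 = 0 ∧ (!![a, 0; b, r] ^ n) 1 1 = r ^ n := by
  induction n with
  | zero => simp
  | succ n ih => simp [pow_succ, Matrix.mul_apply, Fin.sum_univ_two, ih.1, ih.2]

theorem genMonomial_testPair (s : Fin 5 → ℂ) (k : ℕ) (m : Fin 4 →₀ ℕ) :
    genMonomial (halfTrace 0) (halfTrace 1) (tracelessPart 0) (tracelessPart 1) k m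
      (testPair s) 1 1 = s 0 ^ k * (s 1 ^ m 0 * s 2 ^ m 1 * s 3 ^ m 2 * s 4 ^ m 3) := by
  have he : !![-s 3, 1; 0, s 3] * !![-s 4, 0; s 0 - 2 * s 3 * s 4, s 4] +
      !![-s 4, 0; s 0 - 2 * s 3 * s 4, s 4] * !![-s 3, 1; 0, s 3] = s 0 • 1 := by
    ext i j
    fin_cases i <;> fin_cases j <;> simp <;> ring
  simp only [genMonomial, Pi.mul_apply, Pi.pow_apply, Pi.add_apply, halfTrace_zero_testPair,
    halfTrace_one_testPair, tracelessPart_zero_testPair, tracelessPart_one_testPair, he,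
    smul_pow, one_pow, smul_mul_assoc, mul_smul_comm, one_mul, mul_one, Matrix.smul_apply,
    smul_eq_mul]
  rw [Matrix.mul_apply, Fin.sum_univ_two, (pow_apply_of_row _).1, (pow_apply_of_row _).2,
    (pow_apply_of_col _).2]
  ring

theorem comm_sq_testPair (s : Fin 5 → ℂ) :
    ((tracelessPart 0 * tracelessPart 1 - tracelessPart 1 * tracelessPart 0) *
      (tracelessPart 0 * tracelessPart 1 - tracelessPart 1 * tracelessPart 0)) (testPair s) =
      (s 0 ^ 2 - 4 * s 3 ^ 2 * s 4 ^ 2) • 1 := by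
  simp only [Pi.mul_apply, Pi.sub_apply, tracelessPart_zero_testPair, tracelessPart_one_testPair]
  ext i j
  fin_cases i <;> fin_cases j <;> simp [Matrix.mul_apply, Fin.sum_univ_two] <;> ring

theorem linearIndependent_monomial_mul (q : MvPolynomial (Fin 5) ℂ) (hq : q ≠ 0) :
    LinearIndependent ℂ fun p : (Σ _ : ℕ, Fin 4 →₀ ℕ) => fun s : Fin 5 → ℂ =>
      s 0 ^ p.1 * (s 1 ^ p.2 0 * s 2 ^ p.2 1 * s 3 ^ p.2 2 * s 4 ^ p.2 3) *
        MvPolynomial.eval s q := by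
  let L : MvPolynomial (Fin 5) ℂ →ₗ[ℂ] ((Fin 5 → ℂ) → ℂ) :=
    { toFun := fun f s => MvPolynomial.eval s (f * q)
      map_add' := fun f g => by funext s; simp [add_mul]
      map_smul' := fun c f => by funext s; simp [MvPolynomial.smul_eval] }
  have hL : LinearMap.ker L = ⊥ := by
    rw [LinearMap.ker_eq_bot']
    intro f hf
    have : f * q = 0 := MvPolynomial.funext fun s => by simpa [L] using congrFun hf s
    exact (mul_eq_zero.1 this).resolve_right hq
  have hinj : Function.Injective fun p : (Σ _ : ℕ, Fin 4 →₀ ℕ) => Finsupp.cons p.1 p.2 := by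
    rintro ⟨k, m⟩ ⟨k', m'⟩ h
    obtain ⟨rfl, rfl⟩ := Finsupp.cons_injective2 h
    rfl
  convert! (((MvPolynomial.basisMonomials (Fin 5) ℂ).linearIndependent.comp _ hinj).map' L hL)
    using 1
  funext p s
  simp [L, MvPolynomial.eval_monomial, Finsupp.prod_fintype, Fin.prod_univ_succ,
    Finsupp.cons_zero, Finsupp.cons_succ, ← mul_assoc]

theorem linearIndependent_genMonomial_mul_comm : LinearIndependent ℂ
    fun p : (Σ _ : ℕ, Fin 4 →₀ ℕ) =>
      genMonomial (halfTrace 0) (halfTrace 1) (tracelessPart 0) (tracelessPart 1) p.1 p.2 *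
        (tracelessPart 0 * tracelessPart 1 - tracelessPart 1 * tracelessPart 0) := by
  let L : MatFun →ₗ[ℂ] ((Fin 5 → ℂ) → ℂ) :=
    { toFun := fun f s => (f * (tracelessPart 0 * tracelessPart 1 -
        tracelessPart 1 * tracelessPart 0)) (testPair s) 1 1
      map_add' := fun f g => by funext s; simp [add_mul]
      map_smul' := fun c f => by funext s; simp }
  let q : MvPolynomial (Fin 5) ℂ := .X 0 ^ 2 - 4 * .X 3 ^ 2 * .X 4 ^ 2
  have hq : q ≠ 0 := fun h => by
    have := congrArg (MvPolynomial.eval ![1, 0, 0, 0, 0]) h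
    simp [q] at this
  refine LinearIndependent.of_comp L ?_
  convert! linearIndependent_monomial_mul q hq using 1
  funext p s
  simp only [Function.comp_apply, L, LinearMap.coe_mk, AddHom.coe_mk]
  rw [mul_assoc, Pi.mul_apply, comm_sq_testPair, mul_smul_comm, mul_one, Matrix.smul_apply,
    genMonomial_testPair]
  simp [q]
  ring

/-- Evaluation at the pair of scalar matrices `(s, 1)`. -/
noncomputable def scalarEval : MatFun →ₗ[ℂ] (ℂ → ℂ) where
  toFun f s := f ![s • 1, 1] 0 0
  map_add' _ _ := rfl
  map_smul' _ _ := rfl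

theorem scalarEval_apply (f : MatFun) (s : ℂ) : scalarEval f s = f ![s • 1, 1] 0 0 := rfl

theorem linearIndependent_scalarEval (n : ℕ) : LinearIndependent ℂ
    (scalarEval ∘ fun i : Fin (n + 1) =>
      genericMatrix 0 ^ (i : ℕ) * genericMatrix 1 ^ (n - i)) := by
  let L : Polynomial ℂ →ₗ[ℂ] (ℂ → ℂ) := LinearMap.pi fun s => Polynomial.leval s
  have hL : LinearMap.ker L = ⊥ := by
    rw [LinearMap.ker_eq_bot']
    exact fun f hf => Polynomial.funext fun s => by simpa [L] using congrFun hf s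
  convert! (((Polynomial.basisMonomials ℂ).linearIndependent.comp (fun i : Fin (n + 1) => (i : ℕ))
    Fin.val_injective).map' L hL) using 1
  funext i s
  simp [scalarEval_apply, L, genericMatrix, smul_pow]

theorem disjoint_orderedSpan_commSpan (n : ℕ) :
    Disjoint (orderedSpan (genericMatrix 0) (genericMatrix 1) n)
      (commSpan (halfTrace 0) (halfTrace 1) (tracelessPart 0) (tracelessPart 1) n) := by
  refine (Submodule.range_ker_disjoint (linearIndependent_scalarEval n)).mono_right ?_
  match n with
  | 0 => simp [commSpan]
  | 1 => simp [commSpan]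
  | n + 2 =>
    rw [commSpan, Submodule.mul_le]
    intro a ha b hb
    obtain ⟨c, rfl⟩ := Submodule.mem_span_singleton.1 hb
    rw [LinearMap.mem_ker]
    funext s
    simp [scalarEval_apply, tracelessPart, genericMatrix, halfTrace]

theorem finrank_orderedSpan (n : ℕ) :
    Module.finrank ℂ (orderedSpan (genericMatrix 0) (genericMatrix 1) n) = n + 1 := by
  rw [orderedSpan, finrank_span_eq_card (linearIndependent_scalarEval n).of_comp]
  simp

theorem finrank_commSpan (n : ℕ) :
    Module.finrank ℂ (commSpan (halfTrace 0) (halfTrace 1) (tracelessPart 0) (tracelessPart 1)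
      (n + 2)) = (genIndex n).card := by
  rw [isGenericPair_matFun.commSpan_eq]
  refine (finrank_span_eq_card
    (linearIndependent_genMonomial_mul_comm.comp _ Subtype.val_injective)).trans ?_
  simp

theorem card_genIndex (n : ℕ) :
    (genIndex n).card = ∑ k ∈ Finset.range (n / 2 + 1), (n - 2 * k + 3).choose 3 := by
  rw [genIndex, Finset.card_sigma]
  refine Finset.sum_congr rfl fun k _ => ?_
  rw [Finset.card_finsuppAntidiag_nat_eq_choose, Finset.card_univ, Fintype.card_fin,
    show 4 + (n - 2 * k) - 1 = n - 2 * k + 3 by omega]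
  exact Nat.choose_symm_add

theorem card_genIndex_add_two (n : ℕ) :
    (genIndex (n + 2)).card = (n + 5).choose 3 + (genIndex n).card := by
  rw [card_genIndex, card_genIndex, show (n + 2) / 2 + 1 = n / 2 + 1 + 1 by omega,
    Finset.sum_range_succ', add_comm]
  congr 1
  refine Finset.sum_congr rfl fun k _ => ?_
  rw [show n + 2 - 2 * (k + 1) = n - 2 * k by omega]

theorem finrank_span_pow (d : ℕ) :
    Module.finrank ℂ ↥(Submodule.span ℂ {genericMatrix 0, genericMatrix 1} ^ d) =
      d + 1 + Module.finrank ℂ (commSpan (halfTrace 0) (halfTrace 1) (tracelessPart 0)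
        (tracelessPart 1) d) := by
  have h := isGenericPair_matFun.span_pow_eq d
  rw [halfTrace_add_tracelessPart, halfTrace_add_tracelessPart] at h
  have : FiniteDimensional ℂ ↥(Submodule.span ℂ {genericMatrix 0, genericMatrix 1} ^ d) := by
    exact Module.Finite.iff_fg.2 (Submodule.FG.pow (Submodule.fg_span (by simp)) d)
  have h1 : FiniteDimensional ℂ (orderedSpan (genericMatrix 0) (genericMatrix 1) d) :=
    Submodule.finiteDimensional_of_le (le_sup_left.trans h.ge)
  have h2 : FiniteDimensional ℂ (commSpan (halfTrace 0) (halfTrace 1) (tracelessPart 0)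
      (tracelessPart 1) d) := Submodule.finiteDimensional_of_le (le_sup_right.trans h.ge)
  have key := Submodule.finrank_sup_add_finrank_inf_eq
    (orderedSpan (genericMatrix 0) (genericMatrix 1) d)
    (commSpan (halfTrace 0) (halfTrace 1) (tracelessPart 0) (tracelessPart 1) d)
  rw [(disjoint_orderedSpan_commSpan d).eq_bot, finrank_bot, add_zero, finrank_orderedSpan] at key
  rw [h, key]

theorem six_mul_choose_three (n : ℕ) : 6 * (n + 3).choose 3 = (n + 3) * (n + 2) * (n + 1) := by
  have := Nat.descFactorial_eq_factorial_mul_choose (n + 3) 3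
  simp [Nat.descFactorial, Nat.factorial] at this
  linarith

theorem finrank_span_pow_eq (d : ℕ) :
    48 * Module.finrank ℂ ↥(Submodule.span ℂ {genericMatrix 0, genericMatrix 1} ^ d) =
      if Even d then d ^ 4 + 4 * d ^ 3 + 2 * d ^ 2 + 44 * d + 48
      else d ^ 4 + 4 * d ^ 3 + 2 * d ^ 2 + 44 * d + 45 := by
  rw [finrank_span_pow]
  match d with
  | 0 => rw [commSpan, finrank_bot]; simp
  | 1 => rw [commSpan, finrank_bot]; simp
  | n + 2 =>
    rw [finrank_commSpan]
    induction n using Nat.twoStepInduction with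
    | zero => simp [card_genIndex]
    | one => simp [card_genIndex, show ¬ Even 3 by decide]
    | more n ih _ =>
      rw [card_genIndex_add_two]
      have h := six_mul_choose_three (n + 2)
      simp only [Nat.even_add, even_two, iff_true] at ih ⊢
      split_ifs at ih ⊢ <;> nlinarith

theorem range_wordProd (d : ℕ) :
    Submodule.span ℂ (Set.range fun I : Fin d → Fin 2 => (fun A => wordProd A I : MatFun)) =
      Submodule.span ℂ {genericMatrix 0, genericMatrix 1} ^ d := by
  have e : (fun I : Fin d → Fin 2 => (fun A => wordProd A I : MatFun)) =
      fun I => (List.ofFn fun j => genericMatrix (I j)).prod := by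
    funext I A
    have := map_list_prod (Pi.evalMonoidHom (fun _ => Matrix (Fin 2) (Fin 2) ℂ) A)
      (List.ofFn fun j => genericMatrix (I j))
    simp only [Pi.evalMonoidHom_apply] at this
    rw [this, List.map_ofFn]
    rfl
  rw [e, Submodule.span_pow]
  congr 1
  ext z
  rw [Set.mem_pow]
  constructor
  · rintro ⟨I, rfl⟩
    refine ⟨fun j => ⟨genericMatrix (I j), ?_⟩, rfl⟩
    generalize I j = i
    fin_cases i <;> simp
  · rintro ⟨f, rfl⟩
    have : ∀ j, ∃ i, genericMatrix i = (f j : MatFun) := fun j => by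
      rcases (f j).2 with h | h
      exacts [⟨0, h.symm⟩, ⟨1, h.symm⟩]
    choose I hI using this
    exact ⟨I, by simp only [hI]⟩

theorem finrank_span_hmpsState (m n d : ℕ) :
    Module.finrank ℂ ↥(Submodule.span ℂ {T : (Fin d → Fin n) → ℂ |
      ∃ (X : Matrix (Fin m) (Fin m) ℂ) (A : Fin n → Matrix (Fin m) (Fin m) ℂ),
        T = hmpsState m n d X A}) =
    Module.finrank ℂ ↥(Submodule.span ℂ (Set.range fun I : Fin d → Fin n =>
      fun A : Fin n → Matrix (Fin m) (Fin m) ℂ => wordProd A I)) := by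
  set S := Submodule.span ℂ {T : (Fin d → Fin n) → ℂ |
      ∃ (X : Matrix (Fin m) (Fin m) ℂ) (A : Fin n → Matrix (Fin m) (Fin m) ℂ),
        T = hmpsState m n d X A} with hS
  let w := fun I : Fin d → Fin n => fun A : Fin n → Matrix (Fin m) (Fin m) ℂ => wordProd A I
  have hker : (LinearMap.ker (Fintype.linearCombination ℂ w)).map
      (dotProductEquiv ℂ (Fin d → Fin n)).toLinearMap = S.dualAnnihilator := by
    ext φ
    obtain ⟨c, rfl⟩ := (dotProductEquiv ℂ (Fin d → Fin n)).surjective φ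
    have e : ∀ (X : Matrix (Fin m) (Fin m) ℂ) A, c ⬝ᵥ hmpsState m n d X A =
        (X * Fintype.linearCombination ℂ w c A).trace := by
      intro X A
      simp [Fintype.linearCombination_apply, dotProduct, hmpsState, w, Finset.mul_sum,
        Matrix.trace_sum]
    have hc : dotProductEquiv ℂ (Fin d → Fin n) c ∈ S.dualAnnihilator ↔
        ∀ X A, c ⬝ᵥ hmpsState m n d X A = 0 := by
      rw [Submodule.mem_dualAnnihilator]
      refine ⟨fun h X A => h _ (Submodule.subset_span ⟨X, A, rfl⟩), fun h T hT => ?_⟩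
      have : S ≤ LinearMap.ker (dotProductEquiv ℂ (Fin d → Fin n) c) := by
        rw [hS, Submodule.span_le]
        rintro _ ⟨X, A, rfl⟩
        exact h X A
      exact this hT
    rw [hc]
    simp only [e]
    refine (Submodule.mem_map_equiv (e := dotProductEquiv ℂ (Fin d → Fin n)) _).trans ?_
    rw [LinearEquiv.symm_apply_apply, LinearMap.mem_ker]
    refine ⟨fun h X A => by simp [h], fun h => funext fun A => ?_⟩
    exact Matrix.ext_iff_trace_mul_left.2 fun X => by simpa using h X A
  have h1 := LinearMap.finrank_range_add_finrank_ker (Fintype.linearCombination ℂ w)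
  have h2 := Subspace.finrank_add_finrank_dualAnnihilator_eq S
  rw [← hker, LinearEquiv.finrank_map_eq] at h2
  rw [Fintype.range_linearCombination] at h1
  change _ = Module.finrank ℂ (Submodule.span ℂ (Set.range w))
  omega

/-- **Dimension formula for the span of `hMPS(2,2,d)`**:
`dim ⟨hMPS(2,2,d)⟩ = (d⁴ + 4d³ + 2d² + 44d + 48)/48` for `d` even and
`(d⁴ + 4d³ + 2d² + 44d + 45)/48` for `d` odd (stated multiplied by 48 to avoid
division). -/
theorem finrank_span_hMPS_two_two (d : ℕ) :
    48 * Module.finrank ℂ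
        ↥(Submodule.span ℂ {T : (Fin d → Fin 2) → ℂ |
            ∃ (X : Matrix (Fin 2) (Fin 2) ℂ) (A : Fin 2 → Matrix (Fin 2) (Fin 2) ℂ),
              T = hmpsState 2 2 d X A}) =
      if Even d then d ^ 4 + 4 * d ^ 3 + 2 * d ^ 2 + 44 * d + 48
      else d ^ 4 + 4 * d ^ 3 + 2 * d ^ 2 + 44 * d + 45 := by
  rw [finrank_span_hmpsState, range_wordProd, finrank_span_pow_eq]
end
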